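/- arXiv:1310.1417 — 6 statements merged into one kernel-verified Lean document; each statement's English description precedes it below -/
import Mathlib

section
/- Let n ≥ 3 and let p_1, …, p_{n−1} be integers, each at least 2. Then the following are equivalent: (i) there exists a finite group Γ generated by involutions ρ_0, …, ρ_{n−1} such that (ρ_i ρ_j)² = 1 whenever |i − j| ≥ 2, Γ satisfies the intersection condition, the order of ρ_{i−1} ρ_i equals p_i for 1 ≤ i ≤ n−1, the order of Γ equals 2 p_1 p_2 ⋯ p_{n−1}, and the subgroup generated by ρ_0ρ_1, ρ_1ρ_2, …, ρ_{n−2}ρ_{n−1} has index 2 in Γ; (ii) the tuple (p_1, …, p_{n−1}) is admissible. -/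
/-- The intersection condition for a group generated by `n` involutions. -/
def interCond {G : Type*} [Group G] {n : ℕ} (ρ : Fin n → G) : Prop :=
  ∀ I J : Set (Fin n),
    Subgroup.closure (ρ '' I) ⊓ Subgroup.closure (ρ '' J) = Subgroup.closure (ρ '' (I ∩ J))

/-- Admissibility of the tuple `(p_1, …, p_{n-1})`: whenever `p i` is odd,
each of `p (i-1)` and `p (i+1)` (insofar as defined) is even and divides `2 * p i`. -/
def Admissible (n : ℕ) (p : ℕ → ℕ) : Prop :=
  ∀ i : ℕ, 1 ≤ i → i ≤ n - 1 → Odd (p i) →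
    (2 ≤ i → Even (p (i - 1)) ∧ p (i - 1) ∣ 2 * p i) ∧
    (i + 1 ≤ n - 1 → Even (p (i + 1)) ∧ p (i + 1) ∣ 2 * p i)

theorem sq_orderOf_le_card_of_core_trivial {G : Type*} [Group G] [Finite G] (z t : G)
    (ht : t * t = 1) (hgen : Subgroup.closure {z, t} = ⊤)
    (hcore : ∀ M : Subgroup G, M ≤ Subgroup.zpowers z → M.Normal → M = ⊥) :
    orderOf z ^ 2 ≤ Nat.card G := by
  have hinv : t⁻¹ = t := inv_eq_of_mul_eq_one_left ht
  set Z := Subgroup.zpowers z with hZ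
  set Z' := Z.map (MulAut.conj t).toMonoidHom with hZ'
  have hmem' : ∀ g, g ∈ Z' ↔ t * g * t ∈ Z := by
    intro g
    constructor
    · rintro ⟨w, hw, rfl⟩
      have : t * (t * w * t⁻¹) * t = w := by
        rw [hinv]; simp only [mul_assoc, ht, mul_one]; rw [← mul_assoc, ht, one_mul]
      simpa [this] using hw
    · intro h
      refine ⟨_, h, ?_⟩
      simp only [MulEquiv.coe_toMonoidHom, MulAut.conj_apply, hinv]
      simp only [mul_assoc, ht, mul_one]; rw [← mul_assoc, ht, one_mul]
  have hbot : Z ⊓ Z' = ⊥ := by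
    apply hcore _ inf_le_left
    rw [← Subgroup.normalizer_eq_top_iff, eq_top_iff, ← hgen, Subgroup.closure_le]
    rintro g (rfl | rfl)
    · have : g ∈ Z := Subgroup.mem_zpowers _
      rw [SetLike.mem_coe, Subgroup.mem_normalizer_iff]
      have hc : ∀ h ∈ Z, g * h * g⁻¹ = h := by
        rintro h ⟨k, rfl⟩
        simp only
        rw [← zpow_one_add, add_comm, zpow_add, zpow_one, mul_inv_cancel_right]
      intro h
      constructor
      · intro hh
        rw [hc h hh.1]; exact hh
      · intro hh
        have h1 : g * h * g⁻¹ ∈ Z := hh.1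
        have h2 : h ∈ Z := by
          have := Z.mul_mem (Z.mul_mem (Z.inv_mem this) h1) this
          simpa [mul_assoc] using this
        rwa [hc h h2] at hh
    · rw [SetLike.mem_coe, Subgroup.mem_normalizer_iff]
      intro h
      simp only [Subgroup.mem_inf, hmem', hinv]
      have : g * (g * h * g) * g = h := by
        simp only [mul_assoc, ht, mul_one]; rw [← mul_assoc, ht, one_mul]
      rw [this]; tauto
  have hdis : Disjoint Z Z' := disjoint_iff.mpr hbot
  have hinj := Subgroup.mul_injective_of_disjoint hdis
  have hcard := Nat.card_le_card_of_injective _ hinj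
  rw [Nat.card_prod] at hcard
  have hc2 : Nat.card Z' = Nat.card Z :=
    Subgroup.card_map_of_injective (MulAut.conj t).injective
  rw [hc2, Nat.card_zpowers] at hcard
  rwa [sq]

theorem commute_of_commute_sq {G : Type*} [Group G] {x z : G} (hx : Odd (orderOf x))
    (h : Commute (x ^ 2) z) : Commute x z := by
  obtain ⟨k, hk⟩ := hx
  have : x = (x ^ 2) ^ (k + 1) := by
    rw [← pow_mul, show 2 * (k + 1) = orderOf x + 1 by omega, pow_succ, pow_orderOf_eq_one,
      one_mul]
  rw [this]; exact h.pow_left _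

universe u

/-- If a finite group is the product of two cyclic subgroups `⟨x⟩` and `⟨y⟩` with `x` of odd order,
`(x * y) ^ 2 = 1`, and an endomorphism inverts both generators, then `y ^ 2` commutes with `x`. -/
theorem commute_sq_of_cyclic_factorization {G : Type u} [Group G] [Finite G] (x y : G) (τ : G →* G)
    (hx : Odd (orderOf x)) (hxy : (x * y) * (x * y) = 1) (hτx : τ x = x⁻¹) (hτy : τ y = y⁻¹)
    (hG : ∀ g : G, ∃ a b : ℤ, g = x ^ a * y ^ b) : Commute x (y ^ 2) := by
  induction hN : Nat.card G using Nat.strong_induction_on generalizing G with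
  | _ N ih =>
  have hτX : ∀ l ∈ Subgroup.zpowers x, τ l = l⁻¹ := by
    rintro _ ⟨k, rfl⟩; simp [hτx]
  have hτY : ∀ l ∈ Subgroup.zpowers y, τ l = l⁻¹ := by
    rintro _ ⟨k, rfl⟩; simp [hτy]
  have hgenx : Subgroup.closure {x, x * y} = ⊤ := by
    rw [eq_top_iff]; intro g _
    obtain ⟨a, b, rfl⟩ := hG g
    have h1 : x ∈ Subgroup.closure {x, x * y} := Subgroup.subset_closure (by simp)
    have h2 : x * y ∈ Subgroup.closure {x, x * y} := Subgroup.subset_closure (by simp)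
    exact mul_mem (zpow_mem h1 _) (zpow_mem ((Subgroup.mul_mem_cancel_left _ h1).mp h2) _)
  have hgeny : Subgroup.closure {y, x * y} = ⊤ := by
    rw [eq_top_iff]; intro g _
    obtain ⟨a, b, rfl⟩ := hG g
    have h1 : y ∈ Subgroup.closure {y, x * y} := Subgroup.subset_closure (by simp)
    have h2 : x * y ∈ Subgroup.closure {y, x * y} := Subgroup.subset_closure (by simp)
    exact mul_mem (zpow_mem ((Subgroup.mul_mem_cancel_right _ h1).mp h2) _) (zpow_mem h1 _)
  have hquot : ∀ M : Subgroup G, M.Normal → M ≠ ⊥ → (∀ l ∈ M, τ l = l⁻¹) →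
      x⁻¹ * (y ^ 2 * x * (y ^ 2)⁻¹) ∈ M := by
    intro M hM hbot hMτ
    have hle : M ≤ M.comap τ := fun l hl ↦ by
      rw [Subgroup.mem_comap, hMτ l hl]; exact M.inv_mem hl
    have hcard : Nat.card (G ⧸ M) < N := by
      rw [← hN, Subgroup.card_eq_card_quotient_mul_card_subgroup M]
      have h1 : 1 < Nat.card M := Subgroup.one_lt_card_iff_ne_bot M |>.mpr hbot
      have h2 : 0 < Nat.card (G ⧸ M) := Nat.card_pos
      nlinarith
    have key := ih _ hcard (QuotientGroup.mk' M x) (QuotientGroup.mk' M y)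
      (QuotientGroup.map M M τ hle)
      (Odd.of_dvd_nat hx (orderOf_map_dvd _ _))
      (by rw [← map_mul, ← map_mul, hxy, map_one])
      (by simp [hτx]) (by simp [hτy])
      (fun g ↦ by
        obtain ⟨g, rfl⟩ := QuotientGroup.mk'_surjective M g
        obtain ⟨a, b, rfl⟩ := hG g
        exact ⟨a, b, by simp⟩) rfl
    rw [← QuotientGroup.ker_mk' M, MonoidHom.mem_ker]
    simp only [map_mul, map_inv, map_pow]
    rw [← key.eq]; group
  by_cases hX : ∀ M : Subgroup G, M ≤ Subgroup.zpowers x → M.Normal → M = ⊥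
  · by_cases hY : ∀ M : Subgroup G, M ≤ Subgroup.zpowers y → M.Normal → M = ⊥
    · have h1 := sq_orderOf_le_card_of_core_trivial x (x * y) hxy hgenx hX
      have h2 := sq_orderOf_le_card_of_core_trivial y (x * y) hxy hgeny hY
      have h3 : Nat.card G ≤ orderOf x * orderOf y := by
        rw [← Nat.card_zpowers, ← Nat.card_zpowers, ← Nat.card_prod]
        refine Nat.card_le_card_of_surjective
          (fun u : Subgroup.zpowers x × Subgroup.zpowers y ↦ (u.1 : G) * u.2) fun g ↦ ?_
        obtain ⟨a, b, rfl⟩ := hG g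
        exact ⟨⟨⟨_, a, rfl⟩, ⟨_, b, rfl⟩⟩, rfl⟩
      have h4 : orderOf x = orderOf y := by
        have := orderOf_pos x; have := orderOf_pos y
        nlinarith [sq_nonneg ((orderOf x : ℤ) - orderOf y)]
      have h5 : Nat.card G = orderOf x ^ 2 := by nlinarith
      have h6 : Odd (orderOf (x * y)) := Odd.of_dvd_nat (h5 ▸ hx.pow) (orderOf_dvd_natCard _)
      have h7 : orderOf (x * y) ∣ 2 := orderOf_dvd_of_pow_eq_one (by rw [sq, hxy])
      have h8 : x * y = 1 := by
        rcases (Nat.dvd_prime Nat.prime_two).mp h7 with h | h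
        · exact orderOf_eq_one_iff.mp h
        · rw [h] at h6; exact absurd h6 (by decide)
      rw [eq_inv_of_mul_eq_one_right h8]
      exact ((Commute.refl x).inv_right).pow_right 2
    · push Not at hY
      obtain ⟨M, hMY, hM, hbot⟩ := hY
      have h1 := hquot M hM hbot fun l hl ↦ hτY l (hMY hl)
      have hw : x * y ^ 2 * x⁻¹ ∈ Subgroup.zpowers y := by
        have h2 := hM.conj_mem _ (M.inv_mem h1) x
        have h3 := mul_mem (hMY h2) (pow_mem (Subgroup.mem_zpowers y) 2)
        convert h3 using 1
        group
      have hcw : y * (x * y ^ 2 * x⁻¹) * y⁻¹ = x * y ^ 2 * x⁻¹ := by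
        obtain ⟨k, hk⟩ := hw
        simp only at hk
        rw [← hk]; group
      apply commute_of_commute_sq hx
      have h5 : x * (x * y ^ 2 * x⁻¹) * x⁻¹ = y ^ 2 := by
        rw [← hcw]
        calc _ = ((x * y) * (x * y)) * y ^ 2 * ((x * y) * (x * y))⁻¹ := by group
          _ = _ := by rw [hxy]; simp
      show x ^ 2 * y ^ 2 = y ^ 2 * x ^ 2
      nth_rewrite 2 [← h5]
      simp only [pow_two, mul_assoc, inv_mul_cancel_left, inv_mul_cancel, mul_one]
  · push Not at hX
    obtain ⟨M, hMX, hM, hbot⟩ := hX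
    have h1 := hquot M hM hbot fun l hl ↦ hτX l (hMX hl)
    set l := x⁻¹ * (y ^ 2 * x * (y ^ 2)⁻¹) with hl
    have hconjx : ∀ m ∈ M, x * m * x⁻¹ = m := by
      intro m hm
      obtain ⟨k, rfl⟩ := hMX hm
      simp only; group
    have hy2 : y ^ 2 * l * (y ^ 2)⁻¹ = l := by
      have ha := hM.conj_mem _ h1 y
      have hb := hM.conj_mem _ ha y
      calc y ^ 2 * l * (y ^ 2)⁻¹ = y * (y * l * y⁻¹) * y⁻¹ := by
            simp only [pow_two, mul_inv_rev, mul_assoc]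
        _ = x * (y * (x * (y * l * y⁻¹) * x⁻¹) * y⁻¹) * x⁻¹ := by
          rw [hconjx _ ha, hconjx _ hb]
        _ = ((x * y) * (x * y)) * l * ((x * y) * (x * y))⁻¹ := by group
        _ = l := by rw [hxy]; simp
    have h2 : y ^ 2 * x * (y ^ 2)⁻¹ = x * l := by rw [hl]; group
    have h3 := congrArg τ h2
    simp only [map_mul, map_pow, map_inv, hτx, hτy, hτX l (hMX h1)] at h3
    have hcl : Commute (y ^ 2) l := by
      have := mul_inv_eq_iff_eq_mul.mp hy2
      exact this
    have hxl : Commute x l := mul_inv_eq_iff_eq_mul.mp (hconjx l h1)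
    have h4 : x * l = (y ^ 2)⁻¹ * x * y ^ 2 := by
      have := congrArg (·⁻¹) h3
      simp only [mul_inv_rev, inv_inv] at this
      rw [hxl.eq, ← this]; group
    have h5 : x = x * l * l := by
      calc x = (y ^ 2)⁻¹ * (y ^ 2 * x * (y ^ 2)⁻¹) * y ^ 2 := by group
        _ = (y ^ 2)⁻¹ * x * (l * y ^ 2) := by rw [h2]; group
        _ = ((y ^ 2)⁻¹ * x * y ^ 2) * l := by rw [← hcl.eq]; group
        _ = x * l * l := by rw [h4]
    have h6 : l ^ 2 = 1 := by
      rw [mul_assoc] at h5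
      rw [sq]; exact (left_eq_mul.mp h5)
    have h7 : Odd (orderOf l) := by
      refine Odd.of_dvd_nat hx ?_
      rw [← Nat.card_zpowers x]
      exact Subgroup.orderOf_dvd_natCard _ (hMX h1)
    have h8 : l = 1 := by
      rcases (Nat.dvd_prime Nat.prime_two).mp (orderOf_dvd_of_pow_eq_one h6) with h | h
      · exact orderOf_eq_one_iff.mp h
      · rw [h] at h7; exact absurd h7 (by decide)
    rw [h8, mul_one] at h2
    exact (mul_inv_eq_iff_eq_mul.mp h2).symm

theorem eq_one_or_eq_of_mem_zpowers {G : Type*} [Group G] {b g : G} (hb : b * b = 1)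
    (hg : g ∈ Subgroup.zpowers b) : g = 1 ∨ g = b := by
  obtain ⟨k, rfl⟩ := hg
  rcases Int.even_or_odd' k with ⟨m, rfl | rfl⟩
  · left; simp only; rw [zpow_mul]; norm_cast; rw [sq, hb, one_zpow]
  · right; simp only; rw [zpow_add, zpow_mul]; norm_cast; rw [sq, hb, one_zpow, one_mul, pow_one]

theorem disjoint_zpowers_of_notMem {G : Type*} [Group G] {P : Subgroup G} {b : G} (hb : b * b = 1)
    (hbP : b ∉ P) : Disjoint P (Subgroup.zpowers b) := by
  rw [Subgroup.disjoint_def]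
  intro g hg hgb
  rcases eq_one_or_eq_of_mem_zpowers hb hgb with h | h
  · exact h
  · exact absurd (h ▸ hg) hbP

theorem card_zpowers_of_involution {G : Type*} [Group G] {b : G} (hb : b * b = 1) (hb1 : b ≠ 1) :
    Nat.card (Subgroup.zpowers b) = 2 := by
  rw [Nat.card_zpowers]; exact orderOf_eq_prime (by rw [sq, hb]) hb1

/-- Adjoining an involution outside a subgroup at least doubles its order. -/
theorem two_mul_card_le {G : Type*} [Group G] [Finite G] {P T : Subgroup G} {b : G}
    (hb : b * b = 1) (hbP : b ∉ P) (hPT : P ≤ T) (hbT : b ∈ T) :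
    2 * Nat.card P ≤ Nat.card T := by
  have hinj := Subgroup.mul_injective_of_disjoint (disjoint_zpowers_of_notMem hb hbP)
  rw [mul_comm, ← card_zpowers_of_involution hb (fun h ↦ hbP (h ▸ P.one_mem)), ← Nat.card_prod]
  refine Nat.card_le_card_of_injective (fun u : P × Subgroup.zpowers b ↦
    (⟨u.1 * u.2, mul_mem (hPT u.1.2) (Subgroup.zpowers_le.mpr hbT u.2.2)⟩ : T)) fun u v h ↦ ?_
  exact hinj (congrArg Subtype.val h)

theorem even_and_dvd_of_tight {G : Type*} [Group G] [Finite G] {R : Subgroup G} (hR : R.index = 2)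
    {a b c : G} (ha : a ∉ R) (hb : b ∉ R) (hc : c ∉ R) (ha2 : a * a = 1) (hb2 : b * b = 1)
    (hc2 : c * c = 1) (hac : (a * c) * (a * c) = 1) (hne : a * c ≠ 1)
    (hinter : Subgroup.closure {a, b} ⊓ Subgroup.closure {b, c} ≤ Subgroup.zpowers b)
    (hcard : Nat.card (Subgroup.closure {a, b, c}) ≤ 2 * (orderOf (a * b) * orderOf (b * c)))
    (hodd : Odd (orderOf (a * b))) :
    Even (orderOf (b * c)) ∧ orderOf (b * c) ∣ 2 * orderOf (a * b) := by
  have hai : a⁻¹ = a := inv_eq_of_mul_eq_one_left ha2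
  have hbi : b⁻¹ = b := inv_eq_of_mul_eq_one_left hb2
  have hci : c⁻¹ = c := inv_eq_of_mul_eq_one_left hc2
  have hxR : a * b ∈ R := by rw [Subgroup.mul_mem_iff_of_index_two hR]; tauto
  have hyR : b * c ∈ R := by rw [Subgroup.mul_mem_iff_of_index_two hR]; tauto
  have hxy' : a * b * (b * c) = a * c := by rw [mul_assoc, ← mul_assoc b, hb2, one_mul]
  set P := Subgroup.closure {a * b, b * c} with hP
  set T := Subgroup.closure {a, b, c} with hT
  have haT : a ∈ T := Subgroup.subset_closure (by simp)
  have hbT : b ∈ T := Subgroup.subset_closure (by simp)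
  have hcT : c ∈ T := Subgroup.subset_closure (by simp)
  have hxP : a * b ∈ P := Subgroup.subset_closure (by simp)
  have hyP : b * c ∈ P := Subgroup.subset_closure (by simp)
  have hPR : P ≤ R := by
    rw [hP, Subgroup.closure_le]; rintro g (rfl | rfl) <;> assumption
  have hPT : P ≤ T := by
    rw [hP, Subgroup.closure_le]
    rintro g (rfl | rfl)
    exacts [mul_mem haT hbT, mul_mem hbT hcT]
  have hcardP : Nat.card P ≤ orderOf (a * b) * orderOf (b * c) := by
    have := two_mul_card_le hb2 (fun h ↦ hb (hPR h)) hPT hbT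
    omega
  have hconj : ∀ g : P, ((MulAut.conj b).toMonoidHom.comp P.subtype) g ∈ P := by
    have : P ≤ P.comap (MulAut.conj b).toMonoidHom := by
      nth_rewrite 1 [hP]
      rw [Subgroup.closure_le]
      rintro g (rfl | rfl)
      · have := P.inv_mem hxP
        simpa [hai, hbi, mul_assoc, hb2] using this
      · have := P.inv_mem hyP
        simpa [hci, hbi, ← mul_assoc, hb2] using this
    intro g
    exact this g.2
  let τ : P →* P := ((MulAut.conj b).toMonoidHom.comp P.subtype).codRestrict P hconj
  let x : P := ⟨a * b, hxP⟩
  let y : P := ⟨b * c, hyP⟩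
  have hox : orderOf x = orderOf (a * b) := Subgroup.orderOf_mk _ _
  have hoy : orderOf y = orderOf (b * c) := Subgroup.orderOf_mk _ _
  have hdis : Disjoint (Subgroup.zpowers x) (Subgroup.zpowers y) := by
    rw [Subgroup.disjoint_def]
    rintro g ⟨k, rfl⟩ ⟨m, hm⟩
    simp only at hm ⊢
    have h1 : ((x ^ k : P) : G) ∈ Subgroup.zpowers b := by
      apply hinter
      refine ⟨?_, ?_⟩
      · rw [SubgroupClass.coe_zpow]
        exact zpow_mem (mul_mem (Subgroup.subset_closure (by simp))
          (Subgroup.subset_closure (by simp))) _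
      · rw [← hm, SubgroupClass.coe_zpow]
        exact zpow_mem (mul_mem (Subgroup.subset_closure (by simp))
          (Subgroup.subset_closure (by simp))) _
    rcases eq_one_or_eq_of_mem_zpowers hb2 h1 with h | h
    · exact Subtype.ext h
    · exact absurd (hPR (h ▸ (x ^ k).2)) hb
  have hinj := Subgroup.mul_injective_of_disjoint hdis
  have hcardXY : Nat.card (Subgroup.zpowers x × Subgroup.zpowers y) =
      orderOf (a * b) * orderOf (b * c) := by
    rw [Nat.card_prod, Nat.card_zpowers, Nat.card_zpowers, hox, hoy]
  have hbij := hinj.bijective_of_nat_card_le (by rw [hcardXY]; exact hcardP)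
  have hcardP' : Nat.card P = orderOf (a * b) * orderOf (b * c) := by
    rw [← hcardXY]; exact (Nat.card_eq_of_bijective _ hbij).symm
  have hcomm := commute_sq_of_cyclic_factorization x y τ (hox ▸ hodd)
    (Subtype.ext (by simp [x, y, hxy', hac]))
    (Subtype.ext (by simp [τ, x, hai, hbi, mul_assoc, hb2]))
    (Subtype.ext (by simp [τ, y, hci, hbi, ← mul_assoc, hb2]))
    (fun g ↦ by
      obtain ⟨⟨⟨_, k, rfl⟩, ⟨_, m, rfl⟩⟩, rfl⟩ := hbij.2 g
      exact ⟨k, m, rfl⟩)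
  constructor
  · have h1 : orderOf (x * y) = 2 := by
      refine orderOf_eq_prime (Subtype.ext ?_) fun h ↦ hne ?_
      · simp [sq, x, y, hxy', hac]
      · have := congrArg Subtype.val h
        simpa [x, y, hxy'] using this
    have h2 := orderOf_dvd_natCard (x * y)
    rw [h1, hcardP'] at h2
    rcases Nat.even_or_odd (orderOf (b * c)) with h | h
    · exact h
    · exact absurd (even_iff_two_dvd.mpr h2) (Nat.not_even_iff_odd.mpr (hodd.mul h))
  · rw [← hoy, ← hox]
    have hxy : x * y * (x * y) = 1 := Subtype.ext (by simp [x, y, hxy', hac])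
    have h1 : y * x * y⁻¹ = x⁻¹ * (y ^ 2)⁻¹ := by
      have : y * x = x⁻¹ * y⁻¹ := by
        rw [eq_inv_mul_iff_mul_eq, eq_inv_iff_mul_eq_one]; simpa only [mul_assoc] using hxy
      rw [this, pow_two]; group
    have h2 : (y * x * y⁻¹) ^ orderOf x = 1 := by
      rw [conj_pow, pow_orderOf_eq_one]; simp
    rw [h1, hcomm.inv_inv.mul_pow, inv_pow, pow_orderOf_eq_one, inv_one, one_mul, inv_pow,
      inv_eq_one, ← pow_mul] at h2
    exact orderOf_dvd_of_pow_eq_one h2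

theorem exists_zpow_of_mem_closure_pair {G : Type*} [Group G] {b c g : G} (hb : b * b = 1)
    (hc : c * c = 1) (hg : g ∈ Subgroup.closure {b, c}) :
    ∃ m : ℤ, g = (b * c) ^ m ∨ g = b * (b * c) ^ m := by
  have hbi : b⁻¹ = b := inv_eq_of_mul_eq_one_left hb
  have hci : c⁻¹ = c := inv_eq_of_mul_eq_one_left hc
  have hcy : ∀ m : ℤ, c * (b * c) ^ m = b * (b * c) ^ (m + 1) := fun m ↦ by
    rw [add_comm, zpow_one_add, ← mul_assoc, ← mul_assoc, hb, one_mul]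
  have hcb : ∀ m : ℤ, c * (b * (b * c) ^ m) = (b * c) ^ (m - 1) := fun m ↦ by
    rw [sub_eq_neg_add, zpow_add, zpow_neg_one, mul_inv_rev, hbi, hci, mul_assoc]
  induction hg using Subgroup.closure_induction_left with
  | one => exact ⟨0, Or.inl (by simp)⟩
  | mul_left x hx y hy ih =>
    obtain ⟨m, rfl | rfl⟩ := ih <;> obtain rfl | rfl := hx
    · exact ⟨m, Or.inr rfl⟩
    · exact ⟨m + 1, Or.inr (hcy m)⟩
    · exact ⟨m, Or.inl (by rw [← mul_assoc, hb, one_mul])⟩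
    · exact ⟨m - 1, Or.inl (hcb m)⟩
  | inv_mul_cancel x hx y hy ih =>
    obtain ⟨m, rfl | rfl⟩ := ih <;> obtain rfl | rfl := hx
    · exact ⟨m, Or.inr (by rw [hbi])⟩
    · exact ⟨m + 1, Or.inr (by rw [hci, hcy])⟩
    · exact ⟨m, Or.inl (by rw [hbi, ← mul_assoc, hb, one_mul])⟩
    · exact ⟨m - 1, Or.inl (by rw [hci, hcb])⟩

theorem card_closure_pair_le {G : Type*} [Group G] [Finite G] {b c : G} (hb : b * b = 1)
    (hc : c * c = 1) : Nat.card (Subgroup.closure {b, c}) ≤ 2 * orderOf (b * c) := by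
  rw [← Nat.card_zpowers, ← Nat.card_eq_two_iff.mpr ⟨false, true, by decide, by
    ext x; cases x <;> simp⟩, ← Nat.card_prod]
  have hbm : b ∈ Subgroup.closure {b, c} := Subgroup.subset_closure (by simp)
  have hcm : c ∈ Subgroup.closure {b, c} := Subgroup.subset_closure (by simp)
  have hle : Subgroup.zpowers (b * c) ≤ Subgroup.closure {b, c} :=
    Subgroup.zpowers_le.mpr (mul_mem hbm hcm)
  refine Nat.card_le_card_of_surjective (fun u : Bool × Subgroup.zpowers (b * c) ↦
    if u.1 then (⟨u.2, hle u.2.2⟩ : Subgroup.closure {b, c})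
    else ⟨b * u.2, mul_mem hbm (hle u.2.2)⟩) ?_
  rintro ⟨g, hg⟩
  obtain ⟨m, rfl | rfl⟩ := exists_zpow_of_mem_closure_pair hb hc hg
  · exact ⟨(true, ⟨_, m, rfl⟩), by simp⟩
  · exact ⟨(false, ⟨_, m, rfl⟩), by simp⟩

theorem card_mul_card_le_card_mul_card_inf {G : Type*} [Group G] [Finite G] {H K L : Subgroup G}
    (hH : H ≤ L) (hK : K ≤ L) :
    Nat.card H * Nat.card K ≤ Nat.card L * Nat.card (H ⊓ K : Subgroup G) := by
  have hcard : ∀ {H K : Subgroup G}, H ≤ K → Nat.card H * H.relIndex K = Nat.card K := by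
    intro H K h
    rw [← Subgroup.relIndex_bot_left, ← Subgroup.relIndex_bot_left K]
    exact Subgroup.relIndex_mul_relIndex _ _ _ bot_le h
  have h1 : Nat.card H * H.relIndex L = Nat.card L := hcard hH
  have h2 : Nat.card (H ⊓ K : Subgroup G) * H.relIndex K = Nat.card K := by
    rw [← Subgroup.inf_relIndex_right H K]
    exact hcard inf_le_right
  have h3 : H.relIndex K ≤ H.relIndex L :=
    Subgroup.relIndex_le_of_le_right hK
      (Subgroup.isFiniteRelIndex_of_finiteIndex (K := L)).relIndex_ne_zero
  rw [← h1, ← h2]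
  calc _ = Nat.card H * Nat.card (H ⊓ K : Subgroup G) * H.relIndex K := by ring
    _ ≤ Nat.card H * Nat.card (H ⊓ K : Subgroup G) * H.relIndex L := Nat.mul_le_mul_left _ h3
    _ = _ := by ring

theorem card_triple_le {G : Type*} [Group G] [Finite G] {R : Subgroup G} (hR : R.index = 2)
    {n : ℕ} {r : ℕ → G} (hrR : ∀ j < n, r j ∉ R) (hr : ∀ j < n, r j * r j = 1)
    (hinter : ∀ I J : Set ℕ, Subgroup.closure (r '' I) ⊓ Subgroup.closure (r '' J) =
      Subgroup.closure (r '' (I ∩ J)))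
    (hcard : Nat.card G ≤ 2 * ∏ j ∈ Finset.range (n - 1), orderOf (r j * r (j + 1)))
    {j : ℕ} (hj : j + 2 < n) :
    Nat.card (Subgroup.closure {r j, r (j + 1), r (j + 2)}) ≤
      2 * (orderOf (r j * r (j + 1)) * orderOf (r (j + 1) * r (j + 2))) := by
  set q : ℕ → ℕ := fun j ↦ orderOf (r j * r (j + 1)) with hq
  set g : ℕ → ℕ := fun m ↦ Nat.card (Subgroup.closure (r '' Set.Iic m)) with hg
  have hqpos : ∀ l, 0 < q l := fun l ↦ orderOf_pos _
  have hmono : ∀ I J : Set ℕ, I ⊆ J → Subgroup.closure (r '' I) ≤ Subgroup.closure (r '' J) :=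
    fun I J h ↦ Subgroup.closure_mono (Set.image_mono h)
  have hpair : ∀ m, m + 1 < n → 2 * q m ≤ Nat.card (Subgroup.closure (r '' {m, m + 1})) := by
    intro m hm
    rw [Set.image_pair, show q m = orderOf (r m * r (m + 1)) from rfl, ← Nat.card_zpowers]
    refine two_mul_card_le (b := r m) (hr m (by omega)) (fun h ↦ hrR m (by omega) ?_)
      (Subgroup.zpowers_le.mpr (mul_mem (Subgroup.subset_closure (by simp))
        (Subgroup.subset_closure (by simp)))) (Subgroup.subset_closure (by simp))
    refine Subgroup.zpowers_le.mpr ?_ h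
    rw [Subgroup.mul_mem_iff_of_index_two hR]
    exact iff_of_false (hrR m (by omega)) (hrR _ hm)
  have hsingle : ∀ m < n, Nat.card (Subgroup.closure (r '' {m})) = 2 := by
    intro m hm
    rw [Set.image_singleton, ← Subgroup.zpowers_eq_closure]
    exact card_zpowers_of_involution (hr m hm) fun h ↦ hrR m hm (h ▸ R.one_mem)
  have hstep : ∀ m, m + 1 < n → g m * q m ≤ g (m + 1) := by
    intro m hm
    have h := card_mul_card_le_card_mul_card_inf (hmono (Set.Iic m) (Set.Iic (m + 1))
      (Set.Iic_subset_Iic.mpr (by omega))) (hmono {m, m + 1} (Set.Iic (m + 1)) (by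
        rintro x (rfl | rfl) <;> simp))
    rw [hinter, show Set.Iic m ∩ {m, m + 1} = {m} by ext x; simp; omega,
      hsingle m (by omega)] at h
    have h2 := Nat.mul_le_mul_left (g m) (hpair m hm)
    simp only [hg] at h2 ⊢
    linarith
  have hchain : ∀ m k, m ≤ k → k < n → g m * ∏ l ∈ Finset.Ico m k, q l ≤ g k := by
    intro m k hmk
    induction k, hmk using Nat.le_induction with
    | base => simp
    | succ k hmk ih =>
      intro hk
      rw [Finset.prod_Ico_succ_top hmk, ← mul_assoc]
      exact (Nat.mul_le_mul_right _ (ih (by omega))).trans (hstep k hk)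
  have hg0 : g 0 = 2 := by
    simp only [hg]
    rw [show Set.Iic 0 = {0} by ext x; simp]
    exact hsingle 0 (by omega)
  set t := Nat.card (Subgroup.closure {r j, r (j + 1), r (j + 2)}) with ht
  have htri : g (j + 1) * t ≤ g (j + 2) * (2 * q j) := by
    have himg : r '' {j, j + 1, j + 2} = {r j, r (j + 1), r (j + 2)} := by
      rw [Set.image_insert_eq, Set.image_pair]
    have h := card_mul_card_le_card_mul_card_inf (hmono (Set.Iic (j + 1)) (Set.Iic (j + 2))
      (Set.Iic_subset_Iic.mpr (by omega))) (hmono {j, j + 1, j + 2} (Set.Iic (j + 2)) (by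
        rintro x (rfl | rfl | rfl) <;> simp))
    rw [hinter, show Set.Iic (j + 1) ∩ {j, j + 1, j + 2} = {j, j + 1} by ext x; simp; omega,
      himg, Set.image_pair] at h
    exact h.trans (Nat.mul_le_mul_left _
      (card_closure_pair_le (hr j (by omega)) (hr (j + 1) (by omega))))
  have h1 := hchain 0 (j + 1) (by omega) (by omega)
  have h2 := hchain (j + 2) (n - 1) (by omega) (by omega)
  have h3 : g (n - 1) ≤ Nat.card G := Subgroup.card_le_card_group _
  rw [hg0, ← Finset.range_eq_Ico] at h1
  rw [← Finset.prod_range_mul_prod_Ico q (show j + 2 ≤ n - 1 by omega),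
    Finset.prod_range_succ] at hcard
  set A := ∏ l ∈ Finset.range (j + 1), q l
  set B := ∏ l ∈ Finset.Ico (j + 2) (n - 1), q l
  have hA : 0 < A := Finset.prod_pos fun l _ ↦ hqpos l
  have hB : 0 < B := Finset.prod_pos fun l _ ↦ hqpos l
  have h4 : 2 * A * B * t ≤ 2 * A * B * (2 * (q j * q (j + 1))) := by
    calc 2 * A * B * t = (2 * A) * t * B := by ring
      _ ≤ g (j + 1) * t * B := by gcongr
      _ ≤ g (j + 2) * (2 * q j) * B := by gcongr
      _ = (g (j + 2) * B) * (2 * q j) := by ring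
      _ ≤ (2 * (A * q (j + 1) * B)) * (2 * q j) := by
        exact Nat.mul_le_mul_right _ ((h2.trans h3).trans hcard)
      _ = _ := by ring
  exact Nat.le_of_mul_le_mul_left h4 (by positivity)

theorem closure_inf_of_interCond {G : Type*} [Group G] {n : ℕ} {ρ : Fin n → G} (h : interCond ρ)
    (I J : Set ℕ) :
    let r : ℕ → G := fun j ↦ if h : j < n then ρ ⟨j, h⟩ else 1
    Subgroup.closure (r '' I) ⊓ Subgroup.closure (r '' J) = Subgroup.closure (r '' (I ∩ J)) := by
  intro r
  have key : ∀ S : Set ℕ, Subgroup.closure (r '' S) =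
      Subgroup.closure (ρ '' {i | (i : ℕ) ∈ S}) := by
    intro S
    apply le_antisymm
    · rw [Subgroup.closure_le]
      rintro _ ⟨j, hj, rfl⟩
      by_cases hjn : j < n
      · exact Subgroup.subset_closure ⟨⟨j, hjn⟩, hj, by simp [r, hjn]⟩
      · simp only [r, hjn, dite_false]; exact one_mem _
    · apply Subgroup.closure_mono
      rintro _ ⟨i, hi, rfl⟩
      exact ⟨i, hi, by simp [r]⟩
  rw [key, key, key, h]
  rfl

theorem admissible_of_tight {n : ℕ} (hn : 3 ≤ n) {p : ℕ → ℕ}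
    {G : Type*} [Group G] [Finite G] {ρ : Fin n → G} (hord : ∀ i, orderOf (ρ i) = 2)
    (htop : Subgroup.closure (Set.range ρ) = ⊤)
    (hcomm : ∀ i j : Fin n, (i : ℕ) + 2 ≤ (j : ℕ) → (ρ i * ρ j) ^ 2 = 1)
    (hinter : interCond ρ)
    (hp : ∀ i j : Fin n, (i : ℕ) + 1 = (j : ℕ) → orderOf (ρ i * ρ j) = p (j : ℕ))
    (hcard : Nat.card G = 2 * ∏ i ∈ Finset.Icc 1 (n - 1), p i)
    (hrot : (Subgroup.closure
      {g : G | ∃ i j : Fin n, (i : ℕ) + 1 = (j : ℕ) ∧ g = ρ i * ρ j}).index = 2) :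
    Admissible n p := by
  set R := Subgroup.closure {g : G | ∃ i j : Fin n, (i : ℕ) + 1 = (j : ℕ) ∧ g = ρ i * ρ j} with hR
  set r : ℕ → G := fun j ↦ if h : j < n then ρ ⟨j, h⟩ else 1 with hr
  have hrρ : ∀ j (h : j < n), r j = ρ ⟨j, h⟩ := fun j h ↦ by simp [hr, h]
  have hr2 : ∀ j < n, r j * r j = 1 := fun j h ↦ by
    rw [hrρ j h, ← sq, ← hord ⟨j, h⟩, pow_orderOf_eq_one]
  have hrinter := closure_inf_of_interCond hinter
  have hconst : ∀ j < n, (r j ∈ R ↔ r 0 ∈ R) := by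
    intro j
    induction j with
    | zero => simp
    | succ j ih =>
      intro h
      rw [← ih (by omega)]
      have : r j * r (j + 1) ∈ R :=
        Subgroup.subset_closure ⟨⟨j, by omega⟩, ⟨j + 1, h⟩, rfl, by rw [hrρ, hrρ]⟩
      exact ((Subgroup.mul_mem_iff_of_index_two hrot).mp this).symm
  have hrR : ∀ j < n, r j ∉ R := by
    intro j hj hjR
    have : R = ⊤ := by
      rw [eq_top_iff, ← htop, Subgroup.closure_le]
      rintro _ ⟨i, rfl⟩
      have h1 := (hconst i i.2).mpr ((hconst j hj).mp hjR)
      rwa [hrρ i i.2] at h1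
    rw [this, Subgroup.index_top] at hrot
    omega
  have hq : ∀ j, j + 1 < n → orderOf (r j * r (j + 1)) = p (j + 1) := fun j h ↦ by
    rw [hrρ j (by omega), hrρ (j + 1) h, hp _ _ rfl]
  have hcard' : Nat.card G ≤ 2 * ∏ j ∈ Finset.range (n - 1), orderOf (r j * r (j + 1)) := by
    rw [hcard, Finset.prod_congr rfl (fun j hj ↦ hq j (by have := Finset.mem_range.mp hj; omega)),
      Finset.range_eq_Ico, Finset.prod_Ico_add' p 0 (n - 1) 1]
    exact le_of_eq rfl
  have hne : ∀ j, j + 2 < n → r j * r (j + 2) ≠ 1 := by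
    intro j hj h
    have h1 : r j = r (j + 2) := by
      rw [eq_inv_of_mul_eq_one_left h]
      exact inv_eq_of_mul_eq_one_left (hr2 _ hj)
    have h2 := hrinter {j} {j + 2}
    simp only [← hr] at h2
    rw [show ({j} ∩ {j + 2} : Set ℕ) = ∅ by ext x; simp, Set.image_singleton,
      Set.image_singleton, ← h1, inf_idem, Set.image_empty, Subgroup.closure_empty] at h2
    have h3 : r j ∈ (⊥ : Subgroup G) := h2 ▸ Subgroup.subset_closure rfl
    exact hrR j (by omega) ((Subgroup.mem_bot.mp h3) ▸ R.one_mem)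
  have hac : ∀ j, j + 2 < n → r j * r (j + 2) * (r j * r (j + 2)) = 1 := fun j hj ↦ by
    rw [hrρ j (by omega), hrρ (j + 2) hj, ← sq]; exact hcomm _ _ le_rfl
  have hinf : ∀ j, j + 2 < n → Subgroup.closure {r j, r (j + 1)} ⊓
      Subgroup.closure {r (j + 1), r (j + 2)} ≤ Subgroup.zpowers (r (j + 1)) := fun j hj ↦ by
    have h := hrinter {j, j + 1} {j + 1, j + 2}
    simp only [← hr] at h
    rw [show ({j, j + 1} ∩ {j + 1, j + 2} : Set ℕ) = {j + 1} by ext x; simp; omega,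
      Set.image_pair, Set.image_pair, Set.image_singleton, ← Subgroup.zpowers_eq_closure] at h
    exact h.le
  have hinv : ∀ i j, i < n → j < n → r i * r j = (r j * r i)⁻¹ := fun i j hi hj ↦ by
    rw [mul_inv_rev, inv_eq_of_mul_eq_one_left (hr2 i hi), inv_eq_of_mul_eq_one_left (hr2 j hj)]
  intro i hi1 hin hodd
  constructor
  · intro h2
    obtain ⟨j, rfl⟩ : ∃ j, i = j + 2 := ⟨i - 2, by omega⟩
    have hj : j + 2 < n := by omega
    have ht := card_triple_le hrot hrR hr2 hrinter hcard' hj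
    have h0 := hinv j (j + 1) (by omega) (by omega)
    have h1 := hinv (j + 1) (j + 2) (by omega) (by omega)
    have h2 := hinv (j + 2) j (by omega) (by omega)
    have key := even_and_dvd_of_tight hrot (hrR (j + 2) hj) (hrR (j + 1) (by omega))
      (hrR j (by omega)) (hr2 _ hj) (hr2 _ (by omega)) (hr2 _ (by omega))
      (by rw [h2, ← mul_inv_rev, hac j hj, inv_one])
      (by rw [h2, ne_eq, inv_eq_one]; exact hne j hj)
      (by rw [inf_comm, Set.pair_comm _ (r j), Set.pair_comm (r (j + 2))]; exact hinf j hj)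
      (by
        rw [show ({r (j + 2), r (j + 1), r j} : Set G) = {r j, r (j + 1), r (j + 2)} by
          ext x; simp; tauto]
        rw [h0, h1, orderOf_inv, orderOf_inv] at ht
        linarith)
      (by rw [← orderOf_inv, ← h1, hq _ hj]; exact hodd)
    rw [← orderOf_inv, ← h0, ← orderOf_inv (r (j + 2) * _), ← h1, hq _ hj, hq _ (by omega)] at key
    exact key
  · intro h2
    obtain ⟨j, rfl⟩ : ∃ j, i = j + 1 := ⟨i - 1, by omega⟩
    have hj : j + 2 < n := by omega
    have key := even_and_dvd_of_tight hrot (hrR j (by omega)) (hrR (j + 1) (by omega))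
      (hrR (j + 2) hj) (hr2 _ (by omega)) (hr2 _ (by omega)) (hr2 _ hj) (hac j hj) (hne j hj)
      (hinf j hj) (card_triple_le hrot hrR hr2 hrinter hcard' hj)
      (by rw [hq _ (by omega)]; exact hodd)
    rw [hq j (by omega), hq (j + 1) hj] at key
    exact key

/-- The relations of a string group whose consecutive generators have product of order dividing
`q j`, together with relations that make it the product of its rank two parabolic subgroups. -/
structure TightRelations {G : Type*} [Group G] (q : ℕ → ℕ) (f : ℕ → G) : Prop where
  sq : ∀ j, f j * f j = 1
  comm : ∀ i j, i + 2 ≤ j → Commute (f i) (f j)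
  pow : ∀ j, (f j * f (j + 1)) ^ q j = 1
  even : ∀ j, Even (q j) → Even (q (j + 1)) →
    f j * (f (j + 1) * f (j + 2)) ^ 2 * f j = (f (j + 1) * f (j + 2)) ^ 2
  left : ∀ j, Odd (q j) →
    f j * (f (j + 1) * f (j + 2)) ^ 2 * f j = ((f (j + 1) * f (j + 2)) ^ 2)⁻¹
  right : ∀ j, Odd (q (j + 1)) →
    f (j + 2) * (f j * f (j + 1)) ^ 2 * f (j + 2) = ((f j * f (j + 1)) ^ 2)⁻¹

theorem zpow_mul_eq_of_left_normalizes {G : Type*} [Group G] {a b c : G} (ha : a * a = 1)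
    (hb : b * b = 1) (hac : Commute a c) {e : ℤ}
    (hy : a * (b * c) ^ 2 * a = ((b * c) ^ 2) ^ e) (k : ℤ) :
    ∃ h ∈ Subgroup.closure {a, b}, ∃ m : ℤ, (b * c) ^ k * a = h * (b * c) ^ m := by
  have hai : a⁻¹ = a := inv_eq_of_mul_eq_one_left ha
  have ham : a ∈ Subgroup.closure {a, b} := Subgroup.subset_closure (by simp)
  have hbm : b ∈ Subgroup.closure {a, b} := Subgroup.subset_closure (by simp)
  have heven : ∀ i : ℤ, ((b * c) ^ 2) ^ i * a = a * ((b * c) ^ 2) ^ (e * i) := fun i ↦ by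
    have h1 : (a * (b * c) ^ 2 * a) ^ i = a * ((b * c) ^ 2) ^ i * a := by
      have := conj_zpow (i := i) (a := a) (b := (b * c) ^ 2)
      rwa [hai] at this
    rw [zpow_mul, ← hy, h1, ← mul_assoc, ← mul_assoc, ha, one_mul]
  have hy2 : ∀ i : ℤ, ((b * c) ^ 2) ^ i = (b * c) ^ (2 * i) := fun i ↦ by
    rw [zpow_mul]; norm_cast
  rcases Int.even_or_odd' k with ⟨i, rfl | rfl⟩
  · exact ⟨a, ham, 2 * (e * i), by rw [← hy2, heven, hy2]⟩
  · refine ⟨b * a * b, mul_mem (mul_mem hbm ham) hbm, 1 + 2 * (e * i), ?_⟩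
    rw [add_comm, zpow_one_add, mul_assoc, ← hy2, heven, zpow_one_add, hy2]
    have : b * c * a = b * a * b * (b * c) := by
      rw [mul_assoc, ← hac.eq, mul_assoc (b * a), ← mul_assoc b b, hb, one_mul, mul_assoc]
    rw [← mul_assoc, this, mul_assoc]

theorem zpow_mul_eq_of_right_inverts {G : Type*} [Group G] {a b c : G} (ha : a * a = 1)
    (hb : b * b = 1) (hc : c * c = 1) (hac : Commute a c)
    (hx : c * (a * b) ^ 2 * c = ((a * b) ^ 2)⁻¹) (k : ℤ) :
    ∃ h ∈ Subgroup.closure {a, b}, ∃ m : ℤ, (b * c) ^ k * a = h * (b * c) ^ m := by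
  have hai : a⁻¹ = a := inv_eq_of_mul_eq_one_left ha
  have hbi : b⁻¹ = b := inv_eq_of_mul_eq_one_left hb
  have hci : c⁻¹ = c := inv_eq_of_mul_eq_one_left hc
  have ham : a ∈ Subgroup.closure {a, b} := Subgroup.subset_closure (by simp)
  have hbm : b ∈ Subgroup.closure {a, b} := Subgroup.subset_closure (by simp)
  set u := (a * b) ^ 2 with hu
  have hum : u ∈ Subgroup.closure {a, b} := pow_mem (mul_mem ham hbm) 2
  have hcu : ∀ i : ℤ, c * u ^ i = u ^ (-i) * c := fun i ↦ by
    have := conj_zpow (i := i) (a := c) (b := u)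
    rw [hci, hx] at this
    rw [zpow_neg, ← inv_zpow, this, mul_assoc, hc, mul_one]
  have hbu : ∀ i : ℤ, b * u ^ i = u ^ (-i) * b := fun i ↦ by
    have := conj_zpow (i := i) (a := b) (b := u)
    have h1 : b * u * b⁻¹ = u⁻¹ := by
      rw [hu, ← inv_pow, mul_inv_rev, hai, hbi, pow_two, pow_two]
      simp only [mul_assoc, hb, mul_one]
    rw [h1] at this
    rw [zpow_neg, ← inv_zpow, this, mul_assoc, inv_mul_cancel, mul_one]
  have hba : b * a = u⁻¹ * (a * b) := by
    rw [hu, pow_two, mul_inv_rev, mul_assoc, inv_mul_cancel, mul_one, mul_inv_rev, hai, hbi]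
  have key : ∀ d ∈ Subgroup.closure {b, c}, ∃ i : ℤ, ∃ d' ∈ Subgroup.closure {b, c},
      d * a = u ^ i * d' ∨ d * a = u ^ i * a * d' := by
    intro d hd
    have hb' : b ∈ Subgroup.closure {b, c} := Subgroup.subset_closure (by simp)
    have hc' : c ∈ Subgroup.closure {b, c} := Subgroup.subset_closure (by simp)
    have hstep : ∀ x ∈ ({b, c} : Set G), ∀ y, (∃ i : ℤ, ∃ d' ∈ Subgroup.closure {b, c},
        y * a = u ^ i * d' ∨ y * a = u ^ i * a * d') → ∃ i : ℤ, ∃ d' ∈ Subgroup.closure {b, c},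
        x * y * a = u ^ i * d' ∨ x * y * a = u ^ i * a * d' := by
      rintro x hx y ⟨i, d', hd', h | h⟩ <;> rw [mul_assoc, h] <;> obtain rfl | rfl := hx
      · exact ⟨-i, x * d', mul_mem hb' hd', Or.inl (by rw [← mul_assoc, hbu, mul_assoc])⟩
      · exact ⟨-i, x * d', mul_mem hc' hd', Or.inl (by rw [← mul_assoc, hcu, mul_assoc])⟩
      · refine ⟨-i - 1, x * d', mul_mem hb' hd', Or.inr ?_⟩
        rw [← mul_assoc, ← mul_assoc, hbu, mul_assoc (u ^ (-i)), hba, zpow_sub_one]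
        simp only [mul_assoc]
      · refine ⟨-i, x * d', mul_mem hc' hd', Or.inr ?_⟩
        rw [← mul_assoc, ← mul_assoc, hcu, mul_assoc (u ^ (-i)), ← hac.eq]
        simp only [mul_assoc]
    induction hd using Subgroup.closure_induction_left with
    | one => exact ⟨0, 1, one_mem _, Or.inr (by simp)⟩
    | mul_left x hx y hy ih => exact hstep x hx y ih
    | inv_mul_cancel x hx y hy ih =>
      have : x⁻¹ = x := by obtain rfl | rfl := hx <;> assumption
      rw [this]; exact hstep x hx y ih
  have hky : (b * c) ^ k ∈ Subgroup.closure {b, c} :=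
    zpow_mem (mul_mem (Subgroup.subset_closure (by simp)) (Subgroup.subset_closure (by simp))) _
  obtain ⟨i, d', hd', h | h⟩ := key _ hky <;>
    obtain ⟨m, rfl | rfl⟩ := exists_zpow_of_mem_closure_pair hb hc hd'
  · exact ⟨u ^ i, zpow_mem hum _, m, h⟩
  · exact ⟨u ^ i * b, mul_mem (zpow_mem hum _) hbm, m, by rw [h, mul_assoc]⟩
  · exact ⟨u ^ i * a, mul_mem (zpow_mem hum _) ham, m, h⟩
  · exact ⟨u ^ i * a * b, mul_mem (mul_mem (zpow_mem hum _) ham) hbm, m, by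
      rw [h]; simp only [mul_assoc]⟩

namespace TightRelations

variable {G : Type*} [Group G] {q : ℕ → ℕ} {f : ℕ → G}

theorem inv_eq (hf : TightRelations q f) (j : ℕ) : (f j)⁻¹ = f j :=
  inv_eq_of_mul_eq_one_left (hf.sq j)

theorem zpow_mul_eq (hf : TightRelations q f) (j : ℕ) (k : ℤ) :
    ∃ h ∈ Subgroup.closure {f j, f (j + 1)}, ∃ m : ℤ,
      (f (j + 1) * f (j + 2)) ^ k * f j = h * (f (j + 1) * f (j + 2)) ^ m := by
  have hac := hf.comm j (j + 2) le_rfl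
  rcases Nat.even_or_odd (q j) with h1 | h1
  · rcases Nat.even_or_odd (q (j + 1)) with h2 | h2
    · exact zpow_mul_eq_of_left_normalizes (hf.sq j) (hf.sq (j + 1)) hac (e := 1)
        (by rw [hf.even j h1 h2, zpow_one]) k
    · exact zpow_mul_eq_of_right_inverts (hf.sq j) (hf.sq (j + 1)) (hf.sq (j + 2)) hac
        (hf.right j h2) k
  · exact zpow_mul_eq_of_left_normalizes (hf.sq j) (hf.sq (j + 1)) hac (e := -1)
      (by rw [hf.left j h1, zpow_neg_one]) k

theorem zpow_mul_right (hf : TightRelations q f) (m : ℕ) (k : ℤ) :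
    (f m * f (m + 1)) ^ k * f m = f m * (f m * f (m + 1)) ^ (-k) := by
  have h := conj_zpow (i := k) (a := f m) (b := f m * f (m + 1))
  have h1 : f m * (f m * f (m + 1)) * (f m)⁻¹ = (f m * f (m + 1))⁻¹ := by
    rw [mul_inv_rev, hf.inv_eq, hf.inv_eq, ← mul_assoc, hf.sq, one_mul]
  rw [h1, inv_zpow, ← zpow_neg] at h
  rw [h, hf.inv_eq, ← mul_assoc, ← mul_assoc, hf.sq, one_mul]

theorem exists_mul_zpow (hf : TightRelations q f) {m : ℕ} {I : Set ℕ}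
    (hI : I ⊆ Set.Iic (m + 1)) (hm : m ∈ I) {g : G} (hg : g ∈ Subgroup.closure (f '' I)) :
    ∃ h ∈ Subgroup.closure (f '' (I ∩ Set.Iic m)), ∃ k : ℤ, g = h * (f m * f (m + 1)) ^ k := by
  have hmem : ∀ l ∈ I, l ≤ m → f l ∈ Subgroup.closure (f '' (I ∩ Set.Iic m)) := fun l hl hlm ↦
    Subgroup.subset_closure ⟨l, ⟨hl, hlm⟩, rfl⟩
  have hstep : ∀ x, ∀ l ∈ I, (∃ h ∈ Subgroup.closure (f '' (I ∩ Set.Iic m)), ∃ k : ℤ,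
      x = h * (f m * f (m + 1)) ^ k) → ∃ h ∈ Subgroup.closure (f '' (I ∩ Set.Iic m)), ∃ k : ℤ,
      x * f l = h * (f m * f (m + 1)) ^ k := by
    rintro x l hl ⟨h, hh, k, rfl⟩
    have hlm : l ≤ m + 1 := hI hl
    obtain hlt | rfl | rfl | rfl : l + 2 ≤ m ∨ m = l + 1 ∨ l = m ∨ l = m + 1 := by omega
    · refine ⟨h * f l, mul_mem hh (hmem l hl (by omega)), k, ?_⟩
      have hc : Commute (f l) ((f m * f (m + 1)) ^ k) :=
        ((hf.comm l m hlt).mul_right (hf.comm l (m + 1) (by omega))).zpow_right k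
      rw [mul_assoc, mul_assoc, hc.eq]
    · obtain ⟨h', hh', k', e⟩ := hf.zpow_mul_eq l k
      refine ⟨h * h', mul_mem hh ?_, k', by rw [mul_assoc, mul_assoc]; exact congrArg _ e⟩
      refine (Subgroup.closure_le _).mpr ?_ hh'
      rintro y (rfl | rfl)
      exacts [hmem _ hl (by omega), hmem _ hm le_rfl]
    · exact ⟨h * f l, mul_mem hh (hmem l hl le_rfl), -k, by
        rw [mul_assoc, hf.zpow_mul_right, mul_assoc]⟩
    · refine ⟨h * f m, mul_mem hh (hmem m hm le_rfl), -k + 1, ?_⟩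
      rw [zpow_add_one, mul_assoc h (f m), ← mul_assoc (f m), ← hf.zpow_mul_right, mul_assoc h,
        mul_assoc _ (f m), ← mul_assoc (f m) (f m), hf.sq, one_mul]
  induction hg using Subgroup.closure_induction_right with
  | one => exact ⟨1, one_mem _, 0, by simp⟩
  | mul_right x hx y hy ih =>
    obtain ⟨l, hl, rfl⟩ := hy
    exact hstep x l hl ih
  | mul_inv_cancel x hx y hy ih =>
    obtain ⟨l, hl, rfl⟩ := hy
    rw [hf.inv_eq]; exact hstep x l hl ih

theorem eq_or_eq_mul (hf : TightRelations q f) {m : ℕ} {I : Set ℕ}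
    (hI : I ⊆ Set.Iic (m + 1)) (hm : m ∉ I) {g : G} (hg : g ∈ Subgroup.closure (f '' I)) :
    ∃ h ∈ Subgroup.closure (f '' (I ∩ Set.Iic m)), g = h ∨ g = h * f (m + 1) := by
  have hstep : ∀ x, ∀ l ∈ I, (∃ h ∈ Subgroup.closure (f '' (I ∩ Set.Iic m)),
      x = h ∨ x = h * f (m + 1)) → ∃ h ∈ Subgroup.closure (f '' (I ∩ Set.Iic m)),
      x * f l = h ∨ x * f l = h * f (m + 1) := by
    rintro x l hl ⟨h, hh, hx⟩
    have hlm : l ≤ m + 1 := hI hl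
    have hne : l ≠ m := fun e ↦ hm (e ▸ hl)
    obtain hlt | rfl : l + 1 ≤ m ∨ l = m + 1 := by omega
    · have hlmem : f l ∈ Subgroup.closure (f '' (I ∩ Set.Iic m)) :=
        Subgroup.subset_closure ⟨l, ⟨hl, show l ≤ m by omega⟩, rfl⟩
      refine ⟨h * f l, mul_mem hh hlmem, ?_⟩
      rcases hx with rfl | rfl
      · exact Or.inl rfl
      · right; rw [mul_assoc, mul_assoc, (hf.comm l (m + 1) (by omega)).eq]
    · refine ⟨h, hh, ?_⟩
      rcases hx with rfl | rfl
      · exact Or.inr rfl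
      · left; rw [mul_assoc, hf.sq, mul_one]
  induction hg using Subgroup.closure_induction_right with
  | one => exact ⟨1, one_mem _, Or.inl rfl⟩
  | mul_right x hx y hy ih =>
    obtain ⟨l, hl, rfl⟩ := hy
    exact hstep x l hl ih
  | mul_inv_cancel x hx y hy ih =>
    obtain ⟨l, hl, rfl⟩ := hy
    rw [hf.inv_eq]; exact hstep x l hl ih

theorem zpow_eq_one (hf : TightRelations q f) {j : ℕ} {k : ℤ} (h : (q j : ℤ) ∣ k) :
    (f j * f (j + 1)) ^ k = 1 := by
  obtain ⟨m, rfl⟩ := h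
  rw [zpow_mul, zpow_natCast, hf.pow, one_zpow]

variable {n : ℕ}

theorem notMem_of_separated (hq : ∀ j, 2 ≤ q j)
    (hsep : ∀ j, j + 1 < n → ∀ k : ℤ, (f j * f (j + 1)) ^ k ∈ Subgroup.closure (f '' Set.Iic j) →
      (q j : ℤ) ∣ k) {j : ℕ} (hj : j + 1 < n) :
    f (j + 1) ∉ Subgroup.closure (f '' Set.Iic j) := by
  intro h
  have hj' : f j ∈ Subgroup.closure (f '' Set.Iic j) := Subgroup.subset_closure ⟨j, by simp, rfl⟩
  have h1 := hsep j hj 1 (by rw [zpow_one]; exact mul_mem hj' h)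
  have h2 := Int.le_of_dvd one_pos h1
  have := hq j
  omega

theorem closure_inf_le (hf : TightRelations q f) (hq : ∀ j, 2 ≤ q j)
    (hsep : ∀ j, j + 1 < n → ∀ k : ℤ, (f j * f (j + 1)) ^ k ∈ Subgroup.closure (f '' Set.Iic j) →
      (q j : ℤ) ∣ k) (m : ℕ) (hm : m < n) :
    ∀ I J : Set ℕ, I ⊆ Set.Iic m → J ⊆ Set.Iic m →
      Subgroup.closure (f '' I) ⊓ Subgroup.closure (f '' J) ≤ Subgroup.closure (f '' (I ∩ J)) := by
  have hmono : ∀ I J : Set ℕ, I ⊆ J → Subgroup.closure (f '' I) ≤ Subgroup.closure (f '' J) :=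
    fun I J h ↦ Subgroup.closure_mono (Set.image_mono h)
  induction m with
  | zero =>
    intro I J hI hJ
    by_cases h : 0 ∈ J
    · refine inf_le_left.trans (hmono _ _ fun x hx ↦ ⟨hx, ?_⟩)
      have : x ≤ 0 := hI hx
      obtain rfl : x = 0 := by omega
      exact h
    · refine inf_le_right.trans (hmono _ _ fun x hx ↦ absurd ?_ h)
      have : x ≤ 0 := hJ hx
      obtain rfl : x = 0 := by omega
      exact hx
  | succ m ih =>
    have ih := ih (by omega)
    have hlow : ∀ J ⊆ Set.Iic (m + 1), m + 1 ∉ J → J ⊆ Set.Iic m := fun J hJ h x hx ↦ by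
      have h1 : x ≤ m + 1 := hJ hx
      have h2 : x ≠ m + 1 := fun e ↦ h (e ▸ hx)
      exact show x ≤ m by omega
    have hone : ∀ I J : Set ℕ, I ⊆ Set.Iic (m + 1) → J ⊆ Set.Iic (m + 1) → m + 1 ∉ J →
        ∀ g ∈ Subgroup.closure (f '' I), g ∈ Subgroup.closure (f '' J) →
          g ∈ Subgroup.closure (f '' (I ∩ J)) := by
      intro I J hI hJ hmJ g hgI hgJ
      have hJ' := hlow J hJ hmJ
      have hgm := hmono _ _ hJ' hgJ
      have hfin : ∀ h ∈ Subgroup.closure (f '' (I ∩ Set.Iic m)), g = h →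
          g ∈ Subgroup.closure (f '' (I ∩ J)) := by
        rintro h hh rfl
        exact hmono _ _ (Set.inter_subset_inter_left _ Set.inter_subset_left)
          (ih _ _ Set.inter_subset_right hJ' ⟨hh, hgJ⟩)
      by_cases hmI : m ∈ I
      · obtain ⟨h, hh, k, e⟩ := hf.exists_mul_zpow hI hmI hgI
        have h1 : (f m * f (m + 1)) ^ k ∈ Subgroup.closure (f '' Set.Iic m) := by
          rw [← inv_mul_eq_iff_eq_mul] at e
          rw [← e]
          exact mul_mem (inv_mem (hmono _ _ Set.inter_subset_right hh)) hgm
        rw [hf.zpow_eq_one (hsep m hm k h1), mul_one] at e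
        exact hfin h hh e
      · obtain ⟨h, hh, e | e⟩ := hf.eq_or_eq_mul hI hmI hgI
        · exact hfin h hh e
        · refine absurd ?_ (notMem_of_separated hq hsep hm)
          rw [← inv_mul_eq_iff_eq_mul] at e
          rw [← e]
          exact mul_mem (inv_mem (hmono _ _ Set.inter_subset_right hh)) hgm
    have htwo : ∀ I J : Set ℕ, I ⊆ Set.Iic (m + 1) → J ⊆ Set.Iic (m + 1) → m + 1 ∈ I → m ∉ J →
        ∀ g ∈ Subgroup.closure (f '' I), g ∈ Subgroup.closure (f '' J) →
          g ∈ Subgroup.closure (f '' (I ∩ J)) := by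
      intro I J hI hJ hI1 hmJ g hgI hgJ
      by_cases hJ1 : m + 1 ∈ J
      · obtain ⟨h, hh, e | e⟩ := hf.eq_or_eq_mul hJ hmJ hgJ
        · exact hmono _ _ (Set.inter_subset_inter_right _ Set.inter_subset_left)
            (hone I (J ∩ Set.Iic m) hI (Set.inter_subset_left.trans hJ) (by simp) g hgI (e ▸ hh))
        · have h1 : h ∈ Subgroup.closure (f '' I) := by
            have : h = g * f (m + 1) := by rw [e, mul_assoc, hf.sq, mul_one]
            rw [this]; exact mul_mem hgI (Subgroup.subset_closure ⟨_, hI1, rfl⟩)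
          have h2 := hmono _ _ (Set.inter_subset_inter_right _ Set.inter_subset_left)
            (hone I (J ∩ Set.Iic m) hI (Set.inter_subset_left.trans hJ) (by simp) h h1 hh)
          rw [e]
          exact mul_mem h2 (Subgroup.subset_closure ⟨_, ⟨hI1, hJ1⟩, rfl⟩)
      · exact hone I J hI hJ hJ1 g hgI hgJ
    rintro I J hI hJ g ⟨hgI, hgJ⟩
    by_cases hJ1 : m + 1 ∉ J
    · exact hone I J hI hJ hJ1 g hgI hgJ
    by_cases hI1 : m + 1 ∉ I
    · rw [Set.inter_comm]; exact hone J I hJ hI hI1 g hgJ hgI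
    push Not at hI1 hJ1
    by_cases hJ0 : m ∉ J
    · exact htwo I J hI hJ hI1 hJ0 g hgI hgJ
    by_cases hI0 : m ∉ I
    · rw [Set.inter_comm]; exact htwo J I hJ hI hJ1 hI0 g hgJ hgI
    push Not at hI0 hJ0
    obtain ⟨h, hh, k, e⟩ := hf.exists_mul_zpow hI hI0 hgI
    obtain ⟨h', hh', k', e'⟩ := hf.exists_mul_zpow hJ hJ0 hgJ
    have h1 : (f m * f (m + 1)) ^ (k - k') = h⁻¹ * h' := by
      rw [zpow_sub, mul_inv_eq_iff_eq_mul, mul_assoc, ← e', e, inv_mul_cancel_left]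
    have h2 : (f m * f (m + 1)) ^ (k - k') = 1 := by
      refine hf.zpow_eq_one (hsep m hm _ ?_)
      rw [h1]
      exact mul_mem (inv_mem (hmono _ _ Set.inter_subset_right hh))
        (hmono _ _ Set.inter_subset_right hh')
    rw [h2, eq_comm, inv_mul_eq_one] at h1
    subst h1
    have h3 := hmono _ _ (Set.inter_subset_inter Set.inter_subset_left Set.inter_subset_left)
      (ih _ _ Set.inter_subset_right Set.inter_subset_right ⟨hh, hh'⟩)
    rw [e]
    have h4 : f m ∈ Subgroup.closure (f '' (I ∩ J)) :=
      Subgroup.subset_closure ⟨m, ⟨hI0, hJ0⟩, rfl⟩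
    have h5 : f (m + 1) ∈ Subgroup.closure (f '' (I ∩ J)) :=
      Subgroup.subset_closure ⟨m + 1, ⟨hI1, hJ1⟩, rfl⟩
    exact mul_mem h3 (zpow_mem (mul_mem h4 h5) _)

theorem orderOf_mul (hf : TightRelations q f)
    (hsep : ∀ j, j + 1 < n → ∀ k : ℤ, (f j * f (j + 1)) ^ k ∈ Subgroup.closure (f '' Set.Iic j) →
      (q j : ℤ) ∣ k) {j : ℕ} (hj : j + 1 < n) : orderOf (f j * f (j + 1)) = q j := by
  apply Nat.dvd_antisymm (orderOf_dvd_of_pow_eq_one (hf.pow j))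
  have := hsep j hj (orderOf (f j * f (j + 1))) (by
    rw [zpow_natCast, pow_orderOf_eq_one]; exact one_mem _)
  exact_mod_cast this

theorem card_closure_Iic (hf : TightRelations q f)
    (hsep : ∀ j, j + 1 < n → ∀ k : ℤ, (f j * f (j + 1)) ^ k ∈ Subgroup.closure (f '' Set.Iic j) →
      (q j : ℤ) ∣ k) (h0 : f 0 ≠ 1) (m : ℕ) (hm : m < n) :
    Nat.card (Subgroup.closure (f '' Set.Iic m)) = 2 * ∏ j ∈ Finset.range m, q j := by
  induction m with
  | zero =>
    rw [show Set.Iic 0 = {0} by ext x; simp, Set.image_singleton, ← Subgroup.zpowers_eq_closure]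
    simpa using card_zpowers_of_involution (hf.sq 0) h0
  | succ m ih =>
    have hmono : Subgroup.closure (f '' Set.Iic m) ≤ Subgroup.closure (f '' Set.Iic (m + 1)) :=
      Subgroup.closure_mono (Set.image_mono (Set.Iic_subset_Iic.mpr (by omega)))
    rw [Finset.prod_range_succ, ← mul_assoc, ← ih (by omega), ← hf.orderOf_mul hsep hm,
      ← Nat.card_zpowers, ← Nat.card_prod]
    have hdis : Disjoint (Subgroup.closure (f '' Set.Iic m))
        (Subgroup.zpowers (f m * f (m + 1))) := by
      rw [Subgroup.disjoint_def]
      rintro _ hx ⟨k, rfl⟩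
      exact hf.zpow_eq_one (hsep m hm k hx)
    have hz : Subgroup.zpowers (f m * f (m + 1)) ≤ Subgroup.closure (f '' Set.Iic (m + 1)) :=
      Subgroup.zpowers_le.mpr (mul_mem (Subgroup.subset_closure ⟨m, by simp, rfl⟩)
        (Subgroup.subset_closure ⟨m + 1, by simp, rfl⟩))
    refine (Nat.card_eq_of_bijective (fun u : Subgroup.closure (f '' Set.Iic m) ×
      Subgroup.zpowers (f m * f (m + 1)) ↦ (⟨u.1 * u.2, mul_mem (hmono u.1.2) (hz u.2.2)⟩ :
        Subgroup.closure (f '' Set.Iic (m + 1)))) ⟨fun u v h ↦ ?_, ?_⟩).symm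
    · exact Subgroup.mul_injective_of_disjoint hdis (congrArg Subtype.val h)
    · rintro ⟨g, hg⟩
      obtain ⟨h, hh, k, rfl⟩ := hf.exists_mul_zpow subset_rfl (by simp) hg
      exact ⟨(⟨h, Subgroup.closure_mono (Set.image_mono Set.inter_subset_right) hh⟩,
        ⟨_, k, rfl⟩), rfl⟩

end TightRelations

theorem TightRelations.of_support {G : Type*} [Group G] {q : ℕ → ℕ} {f : ℕ → G} (i : ℕ)
    (hadm : ∀ j, (Odd (q j) → Even (q (j + 1))) ∧ (Odd (q (j + 1)) → Even (q j)))
    (hout : ∀ j, j + 1 < i ∨ i + 2 < j → f j = 1) (hsq : ∀ j, f j * f j = 1)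
    (hpow : (f i * f (i + 1)) ^ q i = 1)
    (hcomm : ∀ j k, j + 2 ≤ k → i ≤ j + 1 → k ≤ i + 2 → Commute (f j) (f k))
    (hleft : ∀ j, j + 1 = i → (Even (q j) ∧ f j = 1) ∨ (Odd (q j) ∧ (f j * f (j + 1)) ^ q j = 1 ∧
      f j * (f (j + 1) * f (j + 2)) ^ 2 * f j = ((f (j + 1) * f (j + 2)) ^ 2)⁻¹))
    (hright : (Even (q (i + 1)) ∧ f (i + 2) = 1) ∨ (Odd (q (i + 1)) ∧
      (f (i + 1) * f (i + 2)) ^ q (i + 1) = 1 ∧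
      f (i + 2) * (f i * f (i + 1)) ^ 2 * f (i + 2) = ((f i * f (i + 1)) ^ 2)⁻¹)) :
    TightRelations q f where
  sq := hsq
  comm j k hjk := by
    by_cases h1 : i ≤ j + 1
    · by_cases h2 : k ≤ i + 2
      · exact hcomm j k hjk h1 h2
      · rw [hout k (by omega)]; exact Commute.one_right _
    · rw [hout j (by omega)]; exact Commute.one_left _
  pow j := by
    have heven : ∀ j l, Even (q j) → f l ^ q j = 1 := fun j l ⟨m, hm⟩ ↦ by
      rw [hm, ← two_mul, pow_mul, pow_two, hsq, one_pow]
    obtain h | h | rfl | rfl | rfl | h : j + 2 < i ∨ j + 2 = i ∨ j + 1 = i ∨ j = i ∨ j = i + 1 ∨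
      i + 1 < j := by omega
    · rw [hout j (by omega), hout (j + 1) (by omega), one_mul, one_pow]
    · rw [hout j (by omega), one_mul]
      rcases hleft (j + 1) h with ⟨-, h1⟩ | ⟨h1, -⟩
      · rw [h1, one_pow]
      · exact heven _ _ ((hadm j).2 h1)
    · rcases hleft j rfl with ⟨h1, h2⟩ | ⟨-, h1, -⟩
      · rw [h2, one_mul, heven _ _ h1]
      · exact h1
    · exact hpow
    · rcases hright with ⟨h1, h2⟩ | ⟨-, h1, -⟩
      · rw [h2, mul_one, heven _ _ h1]
      · exact h1
    · rw [hout (j + 1) (by omega), mul_one]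
      by_cases h2 : i + 2 < j
      · rw [hout j (by omega), one_pow]
      obtain rfl : j = i + 2 := by omega
      rcases hright with ⟨-, h1⟩ | ⟨h1, -⟩
      · rw [h1, one_pow]
      · exact heven _ _ ((hadm (i + 1)).1 h1)
  even j h1 h2 := by
    obtain h | rfl | rfl | h : j + 1 < i ∨ j + 1 = i ∨ j = i ∨ i < j := by omega
    · rw [hout j (by omega), one_mul, mul_one]
    · rcases hleft j rfl with ⟨-, h3⟩ | ⟨h3, -⟩
      · rw [h3, one_mul, mul_one]
      · exact absurd h1 (Nat.not_even_iff_odd.mpr h3)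
    · rcases hright with ⟨-, h3⟩ | ⟨h3, -⟩
      · rw [h3, mul_one, pow_two, hsq, mul_one, hsq]
      · exact absurd h2 (Nat.not_even_iff_odd.mpr h3)
    · rw [hout (j + 2) (by omega), mul_one, pow_two, hsq, mul_one, hsq]
  left j h1 := by
    obtain h | h | h | rfl | rfl | h : j + 3 < i ∨ j + 3 = i ∨ j + 2 = i ∨ j + 1 = i ∨ j = i ∨
      i < j := by omega
    · rw [hout j (by omega), hout (j + 1) (by omega), hout (j + 2) (by omega)]; simp
    · rw [hout j (by omega), hout (j + 1) (by omega), one_mul, one_mul, pow_two, hsq]; simp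
    · rcases hleft (j + 1) h with ⟨-, h3⟩ | ⟨h3, -⟩
      · rw [h3, hout j (by omega), one_mul, one_mul, pow_two, hsq]; simp
      · exact absurd ((hadm j).1 h1) (Nat.not_even_iff_odd.mpr h3)
    · rcases hleft j rfl with ⟨h3, -⟩ | ⟨-, -, h3⟩
      · exact absurd h3 (Nat.not_even_iff_odd.mpr h1)
      · exact h3
    · rcases hright with ⟨-, h3⟩ | ⟨h3, -⟩
      · rw [h3, mul_one, pow_two, hsq, mul_one, hsq, inv_one]
      · exact absurd ((hadm j).1 h1) (Nat.not_even_iff_odd.mpr h3)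
    · rw [hout (j + 2) (by omega), mul_one, pow_two, hsq, mul_one, hsq, inv_one]
  right j h1 := by
    obtain h | rfl | rfl | rfl | h : j + 1 < i ∨ j + 1 = i ∨ j = i ∨ j = i + 1 ∨ i + 1 < j := by
      omega
    · rw [hout j (by omega), one_mul, pow_two, hsq, mul_one, hsq, inv_one]
    · rcases hleft j rfl with ⟨-, h3⟩ | ⟨h3, -⟩
      · rw [h3, one_mul, pow_two, hsq, mul_one, hsq, inv_one]
      · exact absurd ((hadm j).1 h3) (Nat.not_even_iff_odd.mpr h1)
    · rcases hright with ⟨h3, -⟩ | ⟨-, -, h3⟩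
      · exact absurd h3 (Nat.not_even_iff_odd.mpr h1)
      · exact h3
    · rcases hright with ⟨-, h3⟩ | ⟨h3, -⟩
      · rw [show i + 1 + 1 = i + 2 from rfl, h3, mul_one, pow_two, hsq, mul_one, hsq, inv_one]
      · exact absurd ((hadm (i + 1)).1 h3) (Nat.not_even_iff_odd.mpr h1)
    · rw [hout (j + 1) (by omega), hout (j + 2) (by omega)]; simp [pow_two, hsq]

theorem exists_tightRelations_dihedral {q : ℕ → ℕ} (i : ℕ) (hqi : q i ≠ 0)
    (hadm : ∀ j, (Odd (q j) → Even (q (j + 1))) ∧ (Odd (q (j + 1)) → Even (q j)))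
    (hl : ∀ j, j + 1 = i → Even (q j)) (hr : Even (q (i + 1))) :
    ∃ (F : Type) (_ : Group F) (_ : Finite F) (f : ℕ → F), TightRelations q f ∧
      ∀ k : ℤ, (f i * f (i + 1)) ^ k ∈ Subgroup.closure (f '' Set.Iic i) → (q i : ℤ) ∣ k := by
  have : NeZero (q i) := ⟨hqi⟩
  let f : ℕ → DihedralGroup (q i) := fun j ↦
    if j = i then DihedralGroup.sr 0 else if j = i + 1 then DihedralGroup.sr 1 else 1
  have hf : ∀ j, j ≠ i → j ≠ i + 1 → f j = 1 := fun j h1 h2 ↦ by simp [f, h1, h2]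
  have hfi : f i = DihedralGroup.sr 0 := by simp [f]
  have hfi1 : f (i + 1) = DihedralGroup.sr 1 := by simp [f]
  have hrot : f i * f (i + 1) = DihedralGroup.r 1 := by simp [hfi, hfi1]
  refine ⟨DihedralGroup (q i), inferInstance, inferInstance, f,
    TightRelations.of_support i hadm (fun j hj ↦ hf j (by omega) (by omega)) (fun j ↦ ?_) ?_
    (fun j k h1 h2 h3 ↦ ?_) (fun j hj ↦ Or.inl ⟨hl j hj, hf j (by omega) (by omega)⟩)
    (Or.inl ⟨hr, hf _ (by omega) (by omega)⟩), fun k hk ↦ ?_⟩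
  · by_cases h1 : j = i
    · simp [h1, hfi]
    by_cases h2 : j = i + 1
    · simp [h2, hfi1]
    simp [hf j h1 h2]
  · rw [hrot, DihedralGroup.r_one_pow_n]
  · by_cases h4 : j + 1 = i
    · rw [hf j (by omega) (by omega)]; exact Commute.one_left _
    · rw [hf k (by omega) (by omega)]; exact Commute.one_right _
  · have hle : Subgroup.closure (f '' Set.Iic i) ≤ Subgroup.zpowers (f i) := by
      rw [Subgroup.closure_le]
      rintro _ ⟨j, hj, rfl⟩
      have hj : j ≤ i := hj
      by_cases h : j = i
      · subst h; exact Subgroup.mem_zpowers _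
      · rw [hf j h (by omega)]; exact one_mem _
    have hdvd : (f i * f (i + 1)) ^ k = 1 → (q i : ℤ) ∣ k := fun h ↦ by
      rw [hrot, ← orderOf_dvd_iff_zpow_eq_one, DihedralGroup.orderOf_r_one] at h
      exact h
    rcases eq_one_or_eq_of_mem_zpowers (by simp [hfi]) (hle hk) with h | h
    · exact hdvd h
    · rw [hrot, hfi, DihedralGroup.r_one_zpow] at h
      cases h

section AffineReflections

variable (R : Type*) [CommRing R]

/-- The involution `(u, v, w) ↦ (-u + v - w, v, w)` of `R³`, paired with a sign. -/
def affineReflectionZero : Equiv.Perm (R × R × R) × ℤˣ :=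
  (Function.Involutive.toPerm (fun x ↦ (-x.1 + x.2.1 - x.2.2, x.2.1, x.2.2))
    fun _ ↦ by ext <;> simp; ring, 1)

/-- The involution `(u, v, w) ↦ (-u, v, w)` of `R³`, paired with a sign. -/
def affineReflectionOne : Equiv.Perm (R × R × R) × ℤˣ :=
  (Function.Involutive.toPerm (fun x ↦ (-x.1, x.2.1, x.2.2)) fun _ ↦ by ext <;> simp, 1)

/-- The involution `(u, v, w) ↦ (u + w, v, -w)` of `R³`, paired with a sign. -/
def affineReflectionTwo : Equiv.Perm (R × R × R) × ℤˣ :=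
  (Function.Involutive.toPerm (fun x ↦ (x.1 + x.2.2, x.2.1, -x.2.2))
    fun _ ↦ by ext <;> simp, -1)

/-- The involution `(u, v, w) ↦ (u, v - 2 w, -w)` of `R³`, paired with a sign. -/
def affineReflectionThree : Equiv.Perm (R × R × R) × ℤˣ :=
  (Function.Involutive.toPerm (fun x ↦ (x.1, x.2.1 - 2 * x.2.2, -x.2.2))
    fun _ ↦ by ext <;> simp, -1)

@[simp]
theorem affineReflectionZero_fst_apply (x : R × R × R) :
    (affineReflectionZero R).1 x = (-x.1 + x.2.1 - x.2.2, x.2.1, x.2.2) := rfl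

@[simp]
theorem affineReflectionOne_fst_apply (x : R × R × R) :
    (affineReflectionOne R).1 x = (-x.1, x.2.1, x.2.2) := rfl

@[simp]
theorem affineReflectionTwo_fst_apply (x : R × R × R) :
    (affineReflectionTwo R).1 x = (x.1 + x.2.2, x.2.1, -x.2.2) := rfl

@[simp]
theorem affineReflectionThree_fst_apply (x : R × R × R) :
    (affineReflectionThree R).1 x = (x.1, x.2.1 - 2 * x.2.2, -x.2.2) := rfl

@[simp]
theorem affineReflectionZero_snd : (affineReflectionZero R).2 = 1 := rfl

@[simp]
theorem affineReflectionOne_snd : (affineReflectionOne R).2 = 1 := rfl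

@[simp]
theorem affineReflectionTwo_snd : (affineReflectionTwo R).2 = -1 := rfl

@[simp]
theorem affineReflectionThree_snd : (affineReflectionThree R).2 = -1 := rfl

theorem affineReflectionZero_mul_self : affineReflectionZero R * affineReflectionZero R = 1 := by
  ext <;> simp; ring

theorem affineReflectionOne_mul_self : affineReflectionOne R * affineReflectionOne R = 1 := by
  ext <;> simp

theorem affineReflectionTwo_mul_self : affineReflectionTwo R * affineReflectionTwo R = 1 := by
  ext <;> simp

theorem affineReflectionThree_mul_self :
    affineReflectionThree R * affineReflectionThree R = 1 := by
  ext <;> simp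

theorem commute_affineReflection_zero_two :
    Commute (affineReflectionZero R) (affineReflectionTwo R) := by
  ext <;> simp; ring

theorem commute_affineReflection_zero_three :
    Commute (affineReflectionZero R) (affineReflectionThree R) := by
  ext <;> simp; ring

theorem commute_affineReflection_one_three :
    Commute (affineReflectionOne R) (affineReflectionThree R) := by
  ext <;> simp

theorem affineReflection_zero_one_pow (m : ℕ) (x : R × R × R) :
    ((affineReflectionZero R * affineReflectionOne R) ^ m).1 x =
      (x.1 + m * (x.2.1 - x.2.2), x.2.1, x.2.2) := by
  induction m with
  | zero => simp
  | succ m ih =>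
    rw [pow_succ', Prod.fst_mul, Equiv.Perm.mul_apply, ih]
    ext <;> simp; ring

theorem affineReflection_two_three_pow (m : ℕ) (x : R × R × R) :
    ((affineReflectionTwo R * affineReflectionThree R) ^ m).1 x =
      (x.1 - m * x.2.2, x.2.1 - 2 * (m * x.2.2), x.2.2) := by
  induction m with
  | zero => simp
  | succ m ih =>
    rw [pow_succ', Prod.fst_mul, Equiv.Perm.mul_apply, ih]
    ext <;> simp <;> ring

theorem affineReflection_one_two_pow_two_mul (m : ℕ) (x : R × R × R) :
    ((affineReflectionOne R * affineReflectionTwo R) ^ (2 * m)).1 x =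
      (x.1 + 2 * (m * x.2.2), x.2.1, x.2.2) := by
  induction m with
  | zero => simp
  | succ m ih =>
    rw [show 2 * (m + 1) = 2 * m + 1 + 1 from rfl, pow_succ', pow_succ']
    simp only [Prod.fst_mul, Equiv.Perm.mul_apply, ih]
    ext <;> simp; ring

theorem affineReflectionZero_inverts :
    affineReflectionZero R * (affineReflectionOne R * affineReflectionTwo R) ^ 2 *
      affineReflectionZero R = ((affineReflectionOne R * affineReflectionTwo R) ^ 2)⁻¹ := by
  rw [eq_inv_iff_mul_eq_one]
  ext <;> simp [pow_two]; ring

theorem affineReflectionThree_inverts :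
    affineReflectionThree R * (affineReflectionOne R * affineReflectionTwo R) ^ 2 *
      affineReflectionThree R = ((affineReflectionOne R * affineReflectionTwo R) ^ 2)⁻¹ := by
  rw [eq_inv_iff_mul_eq_one]
  ext <;> simp [pow_two]

end AffineReflections

theorem exists_tightRelations_affine {q : ℕ → ℕ} (i k : ℕ) (hk : Odd k) (hqi : q i = 2 * k)
    (hadm : ∀ j, (Odd (q j) → Even (q (j + 1))) ∧ (Odd (q (j + 1)) → Even (q j)))
    (hl : ∀ j, j + 1 = i → Odd (q j) → k ∣ q j) (hr : Odd (q (i + 1)) → k ∣ q (i + 1)) :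
    ∃ (F : Type) (_ : Group F) (_ : Finite F) (f : ℕ → F), TightRelations q f ∧
      ∀ k : ℤ, (f i * f (i + 1)) ^ k ∈ Subgroup.closure (f '' Set.Iic i) → (q i : ℤ) ∣ k := by
  have : NeZero k := ⟨fun h ↦ by simp [h] at hk⟩
  let R := ZMod k
  let f : ℕ → Equiv.Perm (R × R × R) × ℤˣ := fun j ↦
    if j = i then affineReflectionOne R else if j = i + 1 then affineReflectionTwo R
    else if j + 1 = i ∧ Odd (q j) then affineReflectionZero R
    else if j = i + 2 ∧ Odd (q (i + 1)) then affineReflectionThree R else 1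
  have h1 : f i = affineReflectionOne R := by simp [f]
  have h2 : f (i + 1) = affineReflectionTwo R := by simp [f]
  have h0 : ∀ j, j + 1 = i → Odd (q j) → f j = affineReflectionZero R := by
    rintro j hj h
    simp only [f]
    rw [if_neg (by omega), if_neg (by omega), if_pos ⟨hj, h⟩]
  have h0' : ∀ j, j + 1 = i → ¬ Odd (q j) → f j = 1 := by
    rintro j hj h
    simp only [f]
    rw [if_neg (by omega), if_neg (by omega), if_neg (fun e ↦ h e.2), if_neg (by omega)]
  have h3 : Odd (q (i + 1)) → f (i + 2) = affineReflectionThree R := fun h ↦ by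
    simp only [f]
    rw [if_neg (by omega), if_neg (by omega), if_neg (by omega), if_pos ⟨trivial, h⟩]
  have h3' : ¬ Odd (q (i + 1)) → f (i + 2) = 1 := fun h ↦ by
    simp only [f]
    rw [if_neg (by omega), if_neg (by omega), if_neg (by omega), if_neg (fun e ↦ h e.2)]
  have hout : ∀ j, j + 1 < i ∨ i + 2 < j → f j = 1 := fun j hj ↦ by
    simp only [f]
    rw [if_neg (by omega), if_neg (by omega), if_neg (by omega), if_neg (by omega)]
  have hsmall : ∀ j, j < i → f j = affineReflectionZero R ∨ f j = 1 := fun j hj ↦ by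
    by_cases h : j + 1 = i
    · by_cases h' : Odd (q j)
      · exact Or.inl (h0 j h h')
      · exact Or.inr (h0' j h h')
    · exact Or.inr (hout j (by omega))
  have hlarge : ∀ j, i + 1 < j → f j = affineReflectionThree R ∨ f j = 1 := fun j hj ↦ by
    by_cases h : j = i + 2
    · subst h
      by_cases h' : Odd (q (i + 1))
      · exact Or.inl (h3 h')
      · exact Or.inr (h3' h')
    · exact Or.inr (hout j (by omega))
  refine ⟨_, inferInstance, inferInstance, f, TightRelations.of_support i hadm hout (fun j ↦ ?_) ?_
    (fun j l hjl hj hl ↦ ?_) (fun j hj ↦ ?_) ?_, fun m hm ↦ ?_⟩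
  · obtain h | rfl | rfl | h : j < i ∨ j = i ∨ j = i + 1 ∨ i + 1 < j := by omega
    · rcases hsmall j h with e | e <;> simp [e, affineReflectionZero_mul_self]
    · rw [h1, affineReflectionOne_mul_self]
    · rw [h2, affineReflectionTwo_mul_self]
    · rcases hlarge j h with e | e <;> simp [e, affineReflectionThree_mul_self]
  · rw [h1, h2, hqi]
    refine Prod.ext (Equiv.ext fun x ↦ ?_) ?_
    · rw [affineReflection_one_two_pow_two_mul]
      simp [R]
    · simp [pow_mul]
  · obtain h | rfl | h : j < i ∨ j = i ∨ i < j := by omega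
    · obtain rfl | h' : l = i + 1 ∨ i + 1 < l := by omega
      · rw [h2]
        rcases hsmall j h with e | e <;> rw [e]
        exacts [commute_affineReflection_zero_two R, Commute.one_left _]
      · rcases hsmall j h with e | e <;> rcases hlarge l h' with e' | e' <;> rw [e, e']
        exacts [commute_affineReflection_zero_three R, Commute.one_right _, Commute.one_left _,
          Commute.one_left _]
    · rw [h1]
      rcases hlarge l (by omega) with e | e <;> rw [e]
      exacts [commute_affineReflection_one_three R, Commute.one_right _]
    · omega
  · by_cases h : Odd (q j)
    · refine Or.inr ⟨h, ?_, ?_⟩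
      · obtain ⟨c, hc⟩ := hl j hj h
        subst hj
        rw [h0 j rfl h, h1]
        refine Prod.ext (Equiv.ext fun x ↦ ?_) ?_
        · rw [affineReflection_zero_one_pow, hc]
          simp [R]
        · simp
      · subst hj
        rw [h0 j rfl h, h1, show j + 2 = j + 1 + 1 from rfl, h2, affineReflectionZero_inverts]
    · exact Or.inl ⟨Nat.not_odd_iff_even.mp h, h0' j hj h⟩
  · by_cases h : Odd (q (i + 1))
    · refine Or.inr ⟨h, ?_, ?_⟩
      · obtain ⟨c, hc⟩ := hr h
        rw [h2, h3 h]
        refine Prod.ext (Equiv.ext fun x ↦ ?_) ?_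
        · rw [affineReflection_two_three_pow, hc]
          simp [R]
        · simp
      · rw [h1, h2, h3 h, affineReflectionThree_inverts]
    · exact Or.inl ⟨Nat.not_odd_iff_even.mp h, h3' h⟩
  · have hfix : ∀ g ∈ Subgroup.closure (f '' Set.Iic i), g.1 (0, 1, 1) = (0, 1, 1) ∧ g.2 = 1 := by
      intro g hg
      let S : Subgroup (Equiv.Perm (R × R × R) × ℤˣ) :=
        (MulAction.stabilizer (Equiv.Perm (R × R × R)) ((0, 1, 1) : R × R × R)).prod ⊥
      have hle : Subgroup.closure (f '' Set.Iic i) ≤ S := by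
        rw [Subgroup.closure_le]
        rintro _ ⟨j, hj, rfl⟩
        have hj : j ≤ i := hj
        obtain h | rfl : j < i ∨ j = i := by omega
        · rcases hsmall j h with e | e <;> rw [e]
          · simp [S, Subgroup.mem_prod]
          · exact one_mem _
        · simp [h1, S, Subgroup.mem_prod]
      have := hle hg
      simpa [S, Subgroup.mem_prod] using this
    have hnat : ∀ m : ℕ, (f i * f (i + 1)) ^ m ∈ Subgroup.closure (f '' Set.Iic i) → q i ∣ m := by
      intro m hm
      obtain ⟨ha, hb⟩ := hfix _ hm
      rw [h1, h2] at ha hb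
      have hm2 : Even m := by
        rw [← neg_one_pow_eq_one_iff_even (R := ℤˣ) (by decide)]
        simpa using hb
      obtain ⟨b, rfl⟩ := even_iff_exists_two_mul.mp hm2
      rw [affineReflection_one_two_pow_two_mul] at ha
      have hb0 : ((2 * b : ℕ) : ZMod k) = 0 := by simpa [R] using congrArg Prod.fst ha
      rw [ZMod.natCast_eq_zero_iff] at hb0
      rw [hqi]
      exact mul_dvd_mul_left 2 (hk.coprime_two_right.dvd_of_dvd_mul_left hb0)
    obtain ⟨m, rfl | rfl⟩ := m.eq_nat_or_neg
    · rw [zpow_natCast] at hm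
      exact_mod_cast hnat m hm
    · rw [zpow_neg, inv_mem_iff, zpow_natCast] at hm
      rw [dvd_neg]
      exact_mod_cast hnat m hm

theorem exists_tightRelations_separating {q : ℕ → ℕ} (i : ℕ) (hqi : q i ≠ 0)
    (hadm : ∀ j, (Odd (q j) → Even (q (j + 1)) ∧ q (j + 1) ∣ 2 * q j) ∧
      (Odd (q (j + 1)) → Even (q j) ∧ q j ∣ 2 * q (j + 1))) :
    ∃ (F : Type) (_ : Group F) (_ : Finite F) (f : ℕ → F), TightRelations q f ∧
      ∀ k : ℤ, (f i * f (i + 1)) ^ k ∈ Subgroup.closure (f '' Set.Iic i) → (q i : ℤ) ∣ k := by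
  have hadm' : ∀ j, (Odd (q j) → Even (q (j + 1))) ∧ (Odd (q (j + 1)) → Even (q j)) :=
    fun j ↦ ⟨fun h ↦ ((hadm j).1 h).1, fun h ↦ ((hadm j).2 h).1⟩
  by_cases h : (∀ j, j + 1 = i → Even (q j)) ∧ Even (q (i + 1))
  · exact exists_tightRelations_dihedral i hqi hadm' h.1 h.2
  have hdvd : (∃ j, j + 1 = i ∧ Odd (q j)) ∨ Odd (q (i + 1)) := by
    by_contra! h'
    exact h ⟨fun j hj ↦ Nat.not_odd_iff_even.mp (h'.1 j hj), Nat.not_odd_iff_even.mp h'.2⟩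
  have hl : ∀ j, j + 1 = i → Odd (q j) → Even (q i) ∧ q i ∣ 2 * q j := by
    rintro j rfl h
    exact (hadm j).1 h
  have hodd : ∀ k a : ℕ, Odd a → 2 * k ∣ 2 * a → Odd k := fun k a ha h ↦
    ha.of_dvd_nat (Nat.dvd_of_mul_dvd_mul_left two_pos h)
  obtain ⟨k, hk, hqk⟩ : ∃ k, Odd k ∧ q i = 2 * k := by
    rcases hdvd with ⟨j, hj, h⟩ | h
    · obtain ⟨h1, h2⟩ := hl j hj h
      obtain ⟨k, hk⟩ := even_iff_exists_two_mul.mp h1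
      exact ⟨k, hodd k _ h (hk ▸ h2), hk⟩
    · obtain ⟨h1, h2⟩ := (hadm i).2 h
      obtain ⟨k, hk⟩ := even_iff_exists_two_mul.mp h1
      exact ⟨k, hodd k _ h (hk ▸ h2), hk⟩
  refine exists_tightRelations_affine i k hk hqk hadm' (fun j hj h ↦ ?_) fun h ↦ ?_
  · exact Nat.dvd_of_mul_dvd_mul_left two_pos (hqk ▸ (hl j hj h).2)
  · exact Nat.dvd_of_mul_dvd_mul_left two_pos (hqk ▸ ((hadm i).2 h).2)

theorem tightRelations_neg_one (q : ℕ → ℕ) : TightRelations q (fun _ ↦ (-1 : ℤˣ)) := by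
  constructor <;> simp

theorem TightRelations.pi {ι : Type*} {F : ι → Type*} [∀ i, Group (F i)] {q : ℕ → ℕ}
    {f : ∀ i, ℕ → F i} (hf : ∀ i, TightRelations q (f i)) :
    TightRelations q (fun j i ↦ f i j) where
  sq j := funext fun i ↦ (hf i).sq j
  comm j k h := funext fun i ↦ (hf i).comm j k h
  pow j := funext fun i ↦ (hf i).pow j
  even j h1 h2 := funext fun i ↦ (hf i).even j h1 h2
  left j h := funext fun i ↦ (hf i).left j h
  right j h := funext fun i ↦ (hf i).right j h

theorem TightRelations.prodMk {G H : Type*} [Group G] [Group H] {q : ℕ → ℕ} {f : ℕ → G}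
    {g : ℕ → H} (hf : TightRelations q f) (hg : TightRelations q g) :
    TightRelations q (fun j ↦ (f j, g j)) where
  sq j := Prod.ext (hf.sq j) (hg.sq j)
  comm j k h := Prod.ext (hf.comm j k h) (hg.comm j k h)
  pow j := Prod.ext (hf.pow j) (hg.pow j)
  even j h1 h2 := Prod.ext (hf.even j h1 h2) (hg.even j h1 h2)
  left j h := Prod.ext (hf.left j h) (hg.left j h)
  right j h := Prod.ext (hf.right j h) (hg.right j h)

theorem dvd_of_map_separated {G H : Type*} [Group G] [Group H] (φ : G →* H) {f : ℕ → G}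
    {g : ℕ → H} (hφ : ∀ j, φ (f j) = g j) {i : ℕ} {d : ℤ}
    (h : ∀ k : ℤ, (g i * g (i + 1)) ^ k ∈ Subgroup.closure (g '' Set.Iic i) → d ∣ k) (k : ℤ)
    (hk : (f i * f (i + 1)) ^ k ∈ Subgroup.closure (f '' Set.Iic i)) : d ∣ k := by
  apply h k
  have := Subgroup.mem_map_of_mem φ hk
  rw [MonoidHom.map_closure, Set.image_image] at this
  simpa only [hφ, map_zpow, map_mul] using this

theorem index_rotation_eq_two {G : Type*} [Group G] {n : ℕ} (hn : 0 < n) {ρ : Fin n → G}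
    (hsq : ∀ i, ρ i * ρ i = 1) (htop : Subgroup.closure (Set.range ρ) = ⊤) (ε : G →* ℤˣ)
    (hε : ∀ i, ε (ρ i) = -1) :
    (Subgroup.closure
      {g : G | ∃ i j : Fin n, (i : ℕ) + 1 = (j : ℕ) ∧ g = ρ i * ρ j}).index = 2 := by
  set R := Subgroup.closure {g : G | ∃ i j : Fin n, (i : ℕ) + 1 = (j : ℕ) ∧ g = ρ i * ρ j} with hR
  let o : Fin n := ⟨0, hn⟩
  have hinv : ∀ i, (ρ i)⁻¹ = ρ i := fun i ↦ inv_eq_of_mul_eq_one_left (hsq i)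
  have hker : R ≤ ε.ker := by
    rw [hR, Subgroup.closure_le]
    rintro _ ⟨i, j, -, rfl⟩
    simp [MonoidHom.mem_ker, hε]
  have h0 : ∀ i (hi : i < n), ρ o * ρ ⟨i, hi⟩ ∈ R := by
    intro i
    induction i with
    | zero => intro hi; exact (hsq o).symm ▸ one_mem R
    | succ i ih =>
      intro hi
      have h1 : ρ ⟨i, by omega⟩ * ρ ⟨i + 1, hi⟩ ∈ R := Subgroup.subset_closure ⟨_, _, rfl, rfl⟩
      have := mul_mem (ih (by omega)) h1
      rwa [mul_assoc, ← mul_assoc (ρ ⟨i, _⟩), hsq, one_mul] at this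
  have h0' : ∀ i, ρ i * ρ o ∈ R := fun i ↦ by
    have := inv_mem (h0 i i.2)
    rwa [mul_inv_rev, hinv, hinv] at this
  have hcover : ∀ g : G, g ∈ R ∨ g * ρ o ∈ R := by
    intro g
    have hg : g ∈ Subgroup.closure (Set.range ρ) := htop ▸ Subgroup.mem_top g
    have hstep : ∀ x i, (x ∈ R ∨ x * ρ o ∈ R) → (x * ρ i ∈ R ∨ x * ρ i * ρ o ∈ R) := by
      rintro x i (h | h)
      · right; rw [mul_assoc]; exact mul_mem h (h0' i)
      · left
        have := mul_mem h (h0 i i.2)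
        rwa [mul_assoc, ← mul_assoc (ρ o), hsq, one_mul] at this
    induction hg using Subgroup.closure_induction_right with
    | one => exact Or.inl (one_mem _)
    | mul_right x hx y hy ih =>
      obtain ⟨i, rfl⟩ := hy
      exact hstep x i ih
    | mul_inv_cancel x hx y hy ih =>
      obtain ⟨i, rfl⟩ := hy
      rw [hinv]; exact hstep x i ih
  rw [Subgroup.index_eq_two_iff]
  refine ⟨ρ o, fun g ↦ ?_⟩
  rcases hcover g with h | h
  · refine Or.inr ⟨h, fun h' ↦ ?_⟩
    have h1 := hker h
    have h2 := hker h'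
    rw [MonoidHom.mem_ker] at h1 h2
    rw [map_mul, h1, hε] at h2
    exact absurd h2 (by decide)
  · refine Or.inl ⟨h, fun h' ↦ ?_⟩
    have h1 := hker h
    have h2 := hker h'
    rw [MonoidHom.mem_ker] at h1 h2
    rw [map_mul, h2, hε] at h1
    exact absurd h1 (by decide)

theorem exists_tight_of_tightRelations {P : Type} [Group P] [Finite P] {q : ℕ → ℕ} {f : ℕ → P}
    (hf : TightRelations q f) (hq : ∀ j, 2 ≤ q j) {n : ℕ} (hn : 0 < n)
    (hsep : ∀ j, j + 1 < n → ∀ k : ℤ, (f j * f (j + 1)) ^ k ∈ Subgroup.closure (f '' Set.Iic j) →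
      (q j : ℤ) ∣ k) (ε : P →* ℤˣ) (hε : ∀ j, ε (f j) = -1) :
    ∃ (G : Type) (_ : Group G) (_ : Finite G) (ρ : Fin n → G),
      (∀ i, orderOf (ρ i) = 2) ∧
      Subgroup.closure (Set.range ρ) = ⊤ ∧
      (∀ i j : Fin n, (i : ℕ) + 2 ≤ (j : ℕ) → (ρ i * ρ j) ^ 2 = 1) ∧
      interCond ρ ∧
      (∀ i j : Fin n, (i : ℕ) + 1 = (j : ℕ) → orderOf (ρ i * ρ j) = q i) ∧
      Nat.card G = 2 * ∏ i ∈ Finset.range (n - 1), q i ∧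
      (Subgroup.closure
        {g : G | ∃ i j : Fin n, (i : ℕ) + 1 = (j : ℕ) ∧ g = ρ i * ρ j}).index = 2 := by
  have hne : ∀ j, f j ≠ 1 := fun j h ↦ by
    have := hε j
    rw [h, map_one] at this
    exact absurd this (by decide)
  set G := Subgroup.closure (f '' Set.Iic (n - 1)) with hG
  have hmem : ∀ i : Fin n, f i ∈ G := fun i ↦
    Subgroup.subset_closure ⟨i, show (i : ℕ) ≤ n - 1 by omega, rfl⟩
  let ρ : Fin n → G := fun i ↦ ⟨f i, hmem i⟩
  have hmap : ∀ I : Set (Fin n), (Subgroup.closure (ρ '' I)).map G.subtype =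
      Subgroup.closure (f '' (Fin.val '' I)) := fun I ↦ by
    rw [MonoidHom.map_closure, Set.image_image, Set.image_image]; rfl
  have hinj := Subgroup.map_injective G.subtype_injective
  have hsq : ∀ i, ρ i * ρ i = 1 := fun i ↦ Subtype.ext (hf.sq i)
  have htop : Subgroup.closure (Set.range ρ) = ⊤ := by
    apply hinj
    rw [← Set.image_univ, hmap, ← MonoidHom.range_eq_map, Subgroup.range_subtype, hG]
    congr 2
    ext x
    simp only [Set.image_univ, Fin.range_val, Set.mem_Iio, Set.mem_Iic]
    omega
  refine ⟨G, inferInstance, inferInstance, ρ, fun i ↦ ?_, htop, fun i j hij ↦ ?_, fun I J ↦ ?_,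
    fun i j hij ↦ ?_, hf.card_closure_Iic hsep (hne 0) (n - 1) (by omega),
    index_rotation_eq_two hn hsq htop (ε.comp G.subtype) fun i ↦ hε i⟩
  · exact orderOf_eq_prime (by rw [pow_two, hsq]) fun h ↦ hne i (congrArg Subtype.val h)
  · have hc : Commute (ρ i) (ρ j) := Subtype.ext (hf.comm i j hij)
    rw [hc.mul_pow, pow_two, pow_two, hsq, hsq, one_mul]
  · apply hinj
    have hle : ∀ I : Set (Fin n), Fin.val '' I ⊆ Set.Iic (n - 1) := by
      rintro I _ ⟨i, -, rfl⟩
      exact show (i : ℕ) ≤ n - 1 by omega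
    rw [Subgroup.map_inf _ _ _ G.subtype_injective, hmap, hmap, hmap,
      Set.image_inter Fin.val_injective]
    exact le_antisymm (hf.closure_inf_le hq hsep (n - 1) (by omega) _ _ (hle I) (hle J))
      (le_inf (Subgroup.closure_mono (Set.image_mono Set.inter_subset_left))
        (Subgroup.closure_mono (Set.image_mono Set.inter_subset_right)))
  · have h1 : ρ i * ρ j = ⟨f i * f (i + 1), mul_mem (hmem i) (hij ▸ hmem j)⟩ :=
      Subtype.ext (congrArg (fun l ↦ f i * f l) hij.symm)
    rw [h1, Subgroup.orderOf_mk, hf.orderOf_mul hsep (by omega)]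

theorem Admissible.exists_tight {n : ℕ} (hn : 0 < n) {p : ℕ → ℕ} (hadm : Admissible n p)
    (hp : ∀ i : ℕ, 1 ≤ i → i ≤ n - 1 → 2 ≤ p i) :
    ∃ (G : Type) (_ : Group G) (_ : Finite G) (ρ : Fin n → G),
      (∀ i, orderOf (ρ i) = 2) ∧
      Subgroup.closure (Set.range ρ) = ⊤ ∧
      (∀ i j : Fin n, (i : ℕ) + 2 ≤ (j : ℕ) → (ρ i * ρ j) ^ 2 = 1) ∧
      interCond ρ ∧
      (∀ i j : Fin n, (i : ℕ) + 1 = (j : ℕ) → orderOf (ρ i * ρ j) = p (j : ℕ)) ∧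
      Nat.card G = 2 * ∏ i ∈ Finset.Icc 1 (n - 1), p i ∧
      (Subgroup.closure
        {g : G | ∃ i j : Fin n, (i : ℕ) + 1 = (j : ℕ) ∧ g = ρ i * ρ j}).index = 2 := by
  let q : ℕ → ℕ := fun j ↦ if j + 1 < n then p (j + 1) else 2
  have hqp : ∀ j, j + 1 < n → q j = p (j + 1) := fun j hj ↦ if_pos hj
  have hq2 : ∀ j, ¬ j + 1 < n → q j = 2 := fun j hj ↦ if_neg hj
  have hq : ∀ j, 2 ≤ q j := fun j ↦ by
    by_cases hj : j + 1 < n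
    · rw [hqp j hj]; exact hp _ (by omega) (by omega)
    · rw [hq2 j hj]
  have hqadm : ∀ j, (Odd (q j) → Even (q (j + 1)) ∧ q (j + 1) ∣ 2 * q j) ∧
      (Odd (q (j + 1)) → Even (q j) ∧ q j ∣ 2 * q (j + 1)) := by
    intro j
    by_cases h1 : j + 1 + 1 < n
    · rw [hqp j (by omega), hqp (j + 1) h1]
      exact ⟨fun h ↦ (hadm (j + 1) (by omega) (by omega) h).2 (by omega),
        fun h ↦ (hadm (j + 1 + 1) (by omega) (by omega) h).1 (by omega)⟩
    · rw [hq2 (j + 1) h1]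
      exact ⟨fun _ ↦ ⟨even_two, dvd_mul_right _ _⟩, fun h ↦ absurd h (by decide)⟩
  have hcomp := fun i ↦ exists_tightRelations_separating i (by have := hq i; omega) hqadm
  choose F iG iF f hf hsep using hcomp
  let g : ℕ → (∀ i : Fin n, F i) × ℤˣ := fun j ↦ (fun i ↦ f i j, -1)
  have hg : TightRelations q g :=
    (TightRelations.pi fun i : Fin n ↦ hf i).prodMk (tightRelations_neg_one q)
  have hgsep : ∀ j, j + 1 < n → ∀ k : ℤ,
      (g j * g (j + 1)) ^ k ∈ Subgroup.closure (g '' Set.Iic j) → (q j : ℤ) ∣ k := fun j hj ↦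
    dvd_of_map_separated (g := f j)
      ((Pi.evalMonoidHom (fun i : Fin n ↦ F i) ⟨j, by omega⟩).comp (MonoidHom.fst _ _))
      (fun _ ↦ rfl) (hsep j)
  obtain ⟨G, iG, iF, ρ, h1, h2, h3, h4, h5, h6, h7⟩ :=
    exists_tight_of_tightRelations hg hq hn hgsep (MonoidHom.snd _ _) fun _ ↦ rfl
  refine ⟨G, iG, iF, ρ, h1, h2, h3, h4, fun i j hij ↦ ?_, ?_, h7⟩
  · rw [h5 i j hij, hqp i (by omega), hij]
  · rw [h6, Finset.prod_congr rfl fun j hj ↦ hqp j (by rw [Finset.mem_range] at hj; omega),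
      Finset.range_eq_Ico, Finset.prod_Ico_add' p 0 (n - 1) 1]
    rfl

/-- There is a finite group generated by `n` involutions with string relations, the intersection
condition, `ρ_{i-1} ρ_i` of order `p_i`, order `2 p_1 ⋯ p_{n-1}`, and rotation subgroup of index 2
(i.e. the automorphism group of a tight orientably-regular `n`-polytope of type
`{p_1, …, p_{n-1}}`) if and only if the tuple `(p_1, …, p_{n-1})` is admissible. -/
theorem tight_orientably_regular_existence
    (n : ℕ) (hn : 3 ≤ n) (p : ℕ → ℕ) (hp : ∀ i : ℕ, 1 ≤ i → i ≤ n - 1 → 2 ≤ p i) :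
    (∃ (G : Type) (_ : Group G) (_ : Finite G) (ρ : Fin n → G),
      (∀ i, orderOf (ρ i) = 2) ∧
      Subgroup.closure (Set.range ρ) = ⊤ ∧
      (∀ i j : Fin n, (i : ℕ) + 2 ≤ (j : ℕ) → (ρ i * ρ j) ^ 2 = 1) ∧
      interCond ρ ∧
      (∀ i j : Fin n, (i : ℕ) + 1 = (j : ℕ) → orderOf (ρ i * ρ j) = p (j : ℕ)) ∧
      Nat.card G = 2 * ∏ i ∈ Finset.Icc 1 (n - 1), p i ∧
      (Subgroup.closure
        {g : G | ∃ i j : Fin n, (i : ℕ) + 1 = (j : ℕ) ∧ g = ρ i * ρ j}).index = 2) ↔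
    Admissible n p := by
  constructor
  · rintro ⟨G, _, _, ρ, hord, htop, hcomm, hinter, hpord, hcard, hrot⟩
    exact admissible_of_tight hn hord htop hcomm hinter hpord hcard hrot
  · exact fun h ↦ h.exists_tight (by omega) hp
end

section
/- Let p ≥ 3 be odd and let q be an even positive integer dividing 2p. Then the group Γ(p,q) is finite of order 2pq. -/
/-- The defining relations of the group `Γ(p, q)`:
`ρ0² = ρ1² = ρ2² = (ρ0ρ1)^p = (ρ1ρ2)^q = (ρ0ρ2)² = (ρ0ρ1ρ2ρ1ρ2)² = 1`. -/
def gamma2Rels (p q : ℕ) : Set (FreeGroup (Fin 3)) :=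
  {(FreeGroup.of 0) ^ 2, (FreeGroup.of 1) ^ 2, (FreeGroup.of 2) ^ 2,
   (FreeGroup.of 0 * FreeGroup.of 1) ^ p, (FreeGroup.of 1 * FreeGroup.of 2) ^ q,
   (FreeGroup.of 0 * FreeGroup.of 2) ^ 2,
   (FreeGroup.of 0 * FreeGroup.of 1 * FreeGroup.of 2 * FreeGroup.of 1 * FreeGroup.of 2) ^ 2}

/-- The group `Γ(p, q)`. -/
abbrev Gamma2 (p q : ℕ) : Type := PresentedGroup (gamma2Rels p q)

/-- The generator `ρ_i` of `Γ(p, q)`. -/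
def rho (p q : ℕ) (i : Fin 3) : Gamma2 p q := PresentedGroup.of i

/-- In a group generated by involutions `x`, `y`, `z` such that `xz` and `x(yz)²` are involutions
as well, every element has the form `(yz)^(2j) (xy)^i s` with `s ∈ {1, y, z, yz}`. -/
theorem exists_eq_zpow_mul_zpow_mul {G : Type*} [Group G] {x y z : G}
    (hgen : Subgroup.closure {x, y, z} = ⊤) (hx : x * x = 1) (hy : y * y = 1) (hz : z * z = 1)
    (hxz : (x * z) * (x * z) = 1) (hn : (x * (y * z) ^ 2) * (x * (y * z) ^ 2) = 1) (g : G) :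
    ∃ (j i : ℤ) (a b : Fin 2),
      g = ((y * z) ^ 2) ^ j * (x * y) ^ i * y ^ (a : ℕ) * z ^ (b : ℕ) := by
  have ix : x⁻¹ = x := inv_eq_of_mul_eq_one_left hx
  have iy : y⁻¹ = y := inv_eq_of_mul_eq_one_left hy
  have iz : z⁻¹ = z := inv_eq_of_mul_eq_one_left hz
  have zx : z * x = x * z := by
    simpa [ix, iz] using inv_eq_of_mul_eq_one_left hxz
  obtain ⟨n, hndef⟩ : ∃ n, n = (y * z) ^ 2 := ⟨_, rfl⟩
  obtain ⟨σ, hσ⟩ : ∃ σ, σ = x * y := ⟨_, rfl⟩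
  have n_inv : n⁻¹ = z * y * (z * y) := by simp [hndef, pow_two, iy, iz]
  have n_eq : n = y * z * (y * z) := by rw [hndef, pow_two]
  have xn : x * n = n⁻¹ * x := by
    rw [← hndef] at hn
    simpa [ix] using (inv_eq_of_mul_eq_one_left hn).symm
  have yn : y * n = n⁻¹ * y := by
    rw [n_inv, n_eq]; simp only [mul_assoc, hy, mul_one]
    rw [← mul_assoc y y, hy, one_mul]
  have comm : Commute σ n := by
    have hi : x * n⁻¹ = n * x := by
      rw [mul_inv_eq_iff_eq_mul, mul_assoc, xn, mul_inv_cancel_left]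
    rw [commute_iff_eq, hσ, mul_assoc, yn, ← mul_assoc, hi, mul_assoc]
  have commi (i : ℤ) : σ ^ i * n = n * σ ^ i := (comm.zpow_left i).eq
  have commi' (i : ℤ) : σ ^ i * n⁻¹ = n⁻¹ * σ ^ i := ((comm.inv_right).zpow_left i).eq
  have σ_inv : σ⁻¹ = y * x := by simp [hσ, ix, iy]
  rw [← hndef, ← hσ]
  have step (g w : G) (hw : w ∈ ({x, y, z} : Set G))
      (h : ∃ (j i : ℤ) (a b : Fin 2), g = n ^ j * σ ^ i * y ^ (a : ℕ) * z ^ (b : ℕ)) :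
      ∃ (j i : ℤ) (a b : Fin 2), g * w = n ^ j * σ ^ i * y ^ (a : ℕ) * z ^ (b : ℕ) := by
    obtain ⟨j, i, a, b, rfl⟩ := h
    have xσ : x = σ * y := by rw [hσ, mul_assoc, hy, mul_one]
    have zy : z * y = n⁻¹ * (y * z) := by
      rw [eq_inv_mul_iff_mul_eq, n_eq, show z * y = (y * z)⁻¹ by simp [iy, iz],
        mul_inv_cancel_right]
    have yzy : y * (z * y) = n * z := by
      rw [n_eq]; simp only [mul_assoc, hz, mul_one]
    rcases hw with rfl | rfl | rfl
    · fin_cases a <;> fin_cases b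
      · exact ⟨j, i + 1, 1, 0, by simp [zpow_add_one, mul_assoc, ← xσ]⟩
      · exact ⟨j, i + 1, 1, 1, by
          simp only [zpow_add_one, mul_assoc]; simp [← mul_assoc σ y, ← xσ, zx]⟩
      · exact ⟨j, i - 1, 0, 0, by simp [zpow_sub_one, mul_assoc, σ_inv]⟩
      · exact ⟨j, i - 1, 0, 1, by simp [zpow_sub_one, mul_assoc, σ_inv, zx]⟩
    · fin_cases a <;> fin_cases b
      · exact ⟨j, i, 1, 0, by simp⟩
      · exact ⟨j - 1, i, 1, 1, by
          simp [zpow_sub_one, mul_assoc, zy]; simp only [← mul_assoc, commi']⟩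
      · exact ⟨j, i, 0, 0, by simp [mul_assoc, hy]⟩
      · exact ⟨j + 1, i, 0, 1, by
          simp [zpow_add_one, mul_assoc, yzy]; simp only [← mul_assoc, commi]⟩
    · fin_cases b
      · exact ⟨j, i, a, 1, by simp⟩
      · exact ⟨j, i, a, 0, by simp [mul_assoc, hz]⟩
  have hg : g ∈ Subgroup.closure {x, y, z} := hgen ▸ Subgroup.mem_top g
  induction hg using Subgroup.closure_induction_right with
  | one => exact ⟨0, 0, 0, 0, by simp⟩
  | mul_right g _ w hw h => exact step g w hw h
  | mul_inv_cancel g _ w hw h =>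
    have : w⁻¹ = w := by rcases hw with rfl | rfl | rfl <;> assumption
    exact this.symm ▸ step g w hw h

/-- If moreover `(xy)^p = 1` and `(yz)^(2m) = 1`, then the group is finite of order at most `4mp`. -/
theorem finite_and_card_le_of_generators {G : Type*} [Group G] {x y z : G} {p m : ℕ}
    (hp : 0 < p) (hm : 0 < m)
    (hgen : Subgroup.closure {x, y, z} = ⊤) (hx : x * x = 1) (hy : y * y = 1) (hz : z * z = 1)
    (hxz : (x * z) * (x * z) = 1) (hn : (x * (y * z) ^ 2) * (x * (y * z) ^ 2) = 1)
    (hxy : (x * y) ^ p = 1) (hyz : ((y * z) ^ 2) ^ m = 1) :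
    Finite G ∧ Nat.card G ≤ m * p * 4 := by
  let f : Subgroup.zpowers ((y * z) ^ 2) × Subgroup.zpowers (x * y) × Fin 2 × Fin 2 → G :=
    fun t ↦ t.1 * t.2.1 * y ^ (t.2.2.1 : ℕ) * z ^ (t.2.2.2 : ℕ)
  have hf : Function.Surjective f := fun g ↦ by
    obtain ⟨j, i, a, b, rfl⟩ := exists_eq_zpow_mul_zpow_mul hgen hx hy hz hxz hn g
    exact ⟨(⟨_, j, rfl⟩, ⟨_, i, rfl⟩, a, b), rfl⟩
  have : Finite (Subgroup.zpowers (x * y)) :=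
    finite_zpowers.mpr (isOfFinOrder_iff_pow_eq_one.mpr ⟨p, hp, hxy⟩)
  have : Finite (Subgroup.zpowers ((y * z) ^ 2)) :=
    finite_zpowers.mpr (isOfFinOrder_iff_pow_eq_one.mpr ⟨m, hm, hyz⟩)
  refine ⟨Finite.of_surjective f hf, (Nat.card_le_card_of_surjective f hf).trans ?_⟩
  simp only [Nat.card_prod, Nat.card_zpowers, Nat.card_fin]
  calc _ = orderOf ((y * z) ^ 2) * orderOf (x * y) * 4 := by ring
    _ ≤ m * p * 4 := by
      gcongr
      · exact orderOf_le_of_pow_eq_one hm hyz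
      · exact orderOf_le_of_pow_eq_one hp hxy

namespace DihedralGroup

theorem subgroup_eq_top_of_mem {n : ℕ} {H : Subgroup (DihedralGroup n)}
    (hr : r 1 ∈ H) (hs : sr 0 ∈ H) : H = ⊤ := by
  have hri (i : ZMod n) : r i ∈ H := by
    obtain ⟨k, rfl⟩ := ZMod.intCast_surjective i
    exact r_one_zpow (n := n) k ▸ H.zpow_mem hr k
  refine (Subgroup.eq_top_iff' H).mpr fun g ↦ ?_
  cases g with
  | r i => exact hri i
  | sr i => simpa using H.mul_mem hs (hri i)

end DihedralGroup

open DihedralGroup in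
/-- Images of the generators of `Γ(p, 2m)` in the model `D_p × D_m`, where `m` is odd. -/
def gammaModel (p m : ℕ) : Fin 3 → DihedralGroup p × DihedralGroup m :=
  ![(sr (-1), sr 1), (sr 0, sr 0), (1, sr 1)]

open DihedralGroup in
theorem lift_gammaModel_eq_one {p m : ℕ} (hmp : m ∣ p) :
    ∀ w ∈ gamma2Rels p (2 * m), FreeGroup.lift (gammaModel p m) w = 1 := by
  have hpm : (p : ZMod m) = 0 := (ZMod.natCast_eq_zero_iff p m).mpr hmp
  rintro w (rfl | rfl | rfl | rfl | rfl | rfl | rfl)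
  all_goals
    simp [gammaModel, pow_mul, pow_two, one_def, hpm, -r_zero]

open DihedralGroup in
theorem subgroup_eq_top_of_gammaModel_mem {p m : ℕ} (hm : Odd m)
    {H : Subgroup (DihedralGroup p × DihedralGroup m)} (h : ∀ i, gammaModel p m i ∈ H) :
    H = ⊤ := by
  obtain ⟨k, rfl⟩ := hm
  have h0 : (sr (-1), sr 1) ∈ H := h 0
  have h1 : (sr 0, sr 0) ∈ H := h 1
  have h2 : (1, sr 1) ∈ H := h 2
  have hs : (sr 0, 1) ∈ H := by
    have := H.pow_mem (H.mul_mem h1 h2) (2 * k + 1)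
    have e : ((sr 0 : DihedralGroup p), (r 1 : DihedralGroup (2 * k + 1))) ^ (2 * k + 1)
        = (sr 0, 1) := by
      rw [Prod.pow_mk, r_one_pow_n, pow_succ, pow_mul, pow_two, sr_mul_self, one_pow, one_mul]
    simpa [e] using this
  have hr : (r 1, 1) ∈ H := by
    simpa [one_def, -r_zero] using H.mul_mem (H.mul_mem h0 h2) hs
  have hs' : (1, sr 0) ∈ H := by
    simpa [one_def, -r_zero] using H.mul_mem hs h1
  have hr' : (1, r 1) ∈ H := by
    simpa [one_def, -r_zero] using H.mul_mem hs' h2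
  have hl : H.comap (MonoidHom.inl _ _) = ⊤ := subgroup_eq_top_of_mem hr hs
  have hrr : H.comap (MonoidHom.inr _ _) = ⊤ := subgroup_eq_top_of_mem hr' hs'
  refine (Subgroup.eq_top_iff' H).mpr fun ⟨a, b⟩ ↦ ?_
  have ha : (a, 1) ∈ H := (Subgroup.eq_top_iff' _).mp hl a
  have hb : (1, b) ∈ H := (Subgroup.eq_top_iff' _).mp hrr b
  simpa using H.mul_mem ha hb

/-- `Γ(p, 2m)` maps onto `D_p × D_m` when `m` is an odd divisor of `p`. -/
theorem toGroup_gammaModel_surjective {p m : ℕ} (hm : Odd m) (hmp : m ∣ p) :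
    Function.Surjective (PresentedGroup.toGroup (lift_gammaModel_eq_one hmp)) :=
  MonoidHom.range_eq_top.mp <| subgroup_eq_top_of_gammaModel_mem hm fun i ↦
    ⟨PresentedGroup.of i, PresentedGroup.toGroup.of _⟩

theorem gamma2_finite_and_card_le (p m : ℕ) (hp : 0 < p) (hm : 0 < m) :
    Finite (Gamma2 p (2 * m)) ∧ Nat.card (Gamma2 p (2 * m)) ≤ m * p * 4 := by
  have rel {w : FreeGroup (Fin 3)} (hw : w ∈ gamma2Rels p (2 * m)) :
      PresentedGroup.mk (gamma2Rels p (2 * m)) w = 1 := PresentedGroup.one_of_mem hw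
  have hgen : Subgroup.closure {rho p (2 * m) 0, rho p (2 * m) 1, rho p (2 * m) 2} = ⊤ := by
    rw [← PresentedGroup.closure_range_of]
    congr 1
    ext g
    simp [Fin.exists_fin_succ, rho, eq_comm]
  refine finite_and_card_le_of_generators hp hm hgen ?_ ?_ ?_ ?_ ?_ ?_ ?_
  · exact (pow_two _).symm.trans (rel (w := .of 0 ^ 2) (by simp [gamma2Rels]))
  · exact (pow_two _).symm.trans (rel (w := .of 1 ^ 2) (by simp [gamma2Rels]))
  · exact (pow_two _).symm.trans (rel (w := .of 2 ^ 2) (by simp [gamma2Rels]))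
  · exact (pow_two _).symm.trans (rel (w := (.of 0 * .of 2) ^ 2) (by simp [gamma2Rels]))
  · have := rel (w := (.of 0 * .of 1 * .of 2 * .of 1 * .of 2) ^ 2) (by simp [gamma2Rels])
    simp only [pow_two, mul_assoc] at this ⊢
    exact this
  · exact rel (w := (.of 0 * .of 1) ^ p) (by simp [gamma2Rels])
  · rw [← pow_mul]
    exact rel (w := (.of 1 * .of 2) ^ (2 * m)) (by simp [gamma2Rels])

/-- If `p ≥ 3` is odd and `q` is an even positive integer dividing `2p`,
then the group `Γ(p,q)` is finite of order `2pq`. -/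
theorem gamma_pq_card (p q : ℕ) (hp3 : 3 ≤ p) (hpodd : Odd p)
    (hq0 : 0 < q) (hqeven : Even q) (hqdvd : q ∣ 2 * p) :
    Finite (Gamma2 p q) ∧ Nat.card (Gamma2 p q) = 2 * p * q := by
  obtain ⟨m, rfl⟩ := hqeven.two_dvd
  have hmp : m ∣ p := Nat.dvd_of_mul_dvd_mul_left two_pos hqdvd
  obtain ⟨hfin, hle⟩ := gamma2_finite_and_card_le p m (by lia) (by lia)
  refine ⟨hfin, le_antisymm (by linarith) ?_⟩
  have hge := Nat.card_le_card_of_surjective _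
    (toGroup_gammaModel_surjective (hpodd.of_dvd_nat hmp) hmp)
  rw [Nat.card_prod, DihedralGroup.nat_card, DihedralGroup.nat_card] at hge
  linarith
end

section
/- Let p ≥ 3 be odd and let q be an even positive integer dividing 2p. Then in the group Γ(p,q), the element ρ0ρ1 has order exactly p and the element ρ1ρ2 has order exactly q. -/
theorem rho_mul_pow_left (p q : ℕ) : (rho p q 0 * rho p q 1) ^ p = 1 :=
  PresentedGroup.one_of_mem (rels := gamma2Rels p q) (by simp [gamma2Rels])

theorem rho_mul_pow_right (p q : ℕ) : (rho p q 1 * rho p q 2) ^ q = 1 :=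
  PresentedGroup.one_of_mem (rels := gamma2Rels p q) (by simp [gamma2Rels])

/-- Elements of a group satisfying the defining relations are the images of the generators. -/
theorem exists_hom_rho {G : Type*} [Group G] (p q : ℕ) (a b c : G)
    (ha : a ^ 2 = 1) (hb : b ^ 2 = 1) (hc : c ^ 2 = 1) (hab : (a * b) ^ p = 1)
    (hbc : (b * c) ^ q = 1) (hac : (a * c) ^ 2 = 1) (habc : (a * b * c * b * c) ^ 2 = 1) :
    ∃ φ : Gamma2 p q →* G, φ (rho p q 0) = a ∧ φ (rho p q 1) = b ∧ φ (rho p q 2) = c := by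
  have h : ∀ r ∈ gamma2Rels p q, FreeGroup.lift ![a, b, c] r = 1 := by
    intro r hr
    simp only [gamma2Rels, Set.mem_insert_iff, Set.mem_singleton_iff] at hr
    rcases hr with rfl | rfl | rfl | rfl | rfl | rfl | rfl <;> simpa
  exact ⟨PresentedGroup.toGroup h, PresentedGroup.toGroup.of h, PresentedGroup.toGroup.of h,
    PresentedGroup.toGroup.of h⟩

/-- Killing `ρ2` maps `Γ(p, q)` onto the dihedral group of order `2p` when `q` is even. -/
theorem dvd_orderOf_rho_mul_left (p q : ℕ) (hq : Even q) :
    p ∣ orderOf (rho p q 0 * rho p q 1) := by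
  obtain ⟨m, rfl⟩ := hq
  obtain ⟨φ, h0, h1, -⟩ := exists_hom_rho p (m + m)
    (DihedralGroup.sr 0 : DihedralGroup p) (DihedralGroup.sr 1) 1
    (by simp [sq]) (by simp [sq]) (by simp) (by simp)
    (by rw [← two_mul, pow_mul]; simp [sq]) (by simp [sq]) (by simp [sq])
  have h := orderOf_map_dvd φ (rho p (m + m) 0 * rho p (m + m) 1)
  simpa [h0, h1] using h

/-- Identifying `ρ0` with `ρ2` maps `Γ(p, q)` onto the dihedral group of order `2k` when `k`
divides `p` and `q`. -/
theorem dvd_orderOf_rho_mul_right {p q k : ℕ} (hp : k ∣ p) (hq : k ∣ q) :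
    k ∣ orderOf (rho p q 1 * rho p q 2) := by
  have hpow : ∀ n, k ∣ n → (DihedralGroup.r (1 : ZMod k)) ^ n = 1 := fun n hn =>
    orderOf_dvd_iff_pow_eq_one.mp (by rwa [DihedralGroup.orderOf_r_one])
  have hinv : (DihedralGroup.sr 1 * DihedralGroup.sr 0 : DihedralGroup k)
      = (DihedralGroup.r 1)⁻¹ := by simp
  obtain ⟨φ, -, h1, h2⟩ := exists_hom_rho p q
    (DihedralGroup.sr 1 : DihedralGroup k) (DihedralGroup.sr 0) (DihedralGroup.sr 1)
    (by simp [sq]) (by simp [sq]) (by simp [sq])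
    (by rw [hinv, inv_pow, hpow p hp, inv_one])
    (by simpa using hpow q hq) (by simp) (by simp [sq])
  have h := orderOf_map_dvd φ (rho p q 1 * rho p q 2)
  simpa [h1, h2] using h

/-- The map to the group of order two that kills `ρ2` and identifies `ρ0` with `ρ1`. -/
theorem two_dvd_orderOf_rho_mul_right (p q : ℕ) (hq : Even q) :
    2 ∣ orderOf (rho p q 1 * rho p q 2) := by
  obtain ⟨m, rfl⟩ := hq
  obtain ⟨φ, -, h1, h2⟩ := exists_hom_rho p (m + m) (-1 : ℤˣ) (-1) 1
    (by simp) (by simp) (by simp) (by simp) (by simp [← two_mul, pow_mul]) (by simp) (by simp)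
  have h := orderOf_map_dvd φ (rho p (m + m) 1 * rho p (m + m) 2)
  have h2' : orderOf (-1 : ℤˣ) = 2 := orderOf_eq_prime (by simp) (by decide)
  simpa [h1, h2, h2'] using h

/-- If `p ≥ 3` is odd and `q` is an even positive integer dividing `2p`, then in `Γ(p,q)`
the element `ρ0 ρ1` has order exactly `p` and the element `ρ1 ρ2` has order exactly `q`. -/
theorem gamma_pq_generator_orders (p q : ℕ) (hp3 : 3 ≤ p) (hpodd : Odd p)
    (hq0 : 0 < q) (hqeven : Even q) (hqdvd : q ∣ 2 * p) :
    orderOf (rho p q 0 * rho p q 1) = p ∧ orderOf (rho p q 1 * rho p q 2) = q := by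
  refine ⟨Nat.dvd_antisymm (orderOf_dvd_of_pow_eq_one (rho_mul_pow_left p q))
    (dvd_orderOf_rho_mul_left p q hqeven),
    Nat.dvd_antisymm (orderOf_dvd_of_pow_eq_one (rho_mul_pow_right p q)) ?_⟩
  obtain ⟨k, hk⟩ := hqeven.two_dvd
  have hkp : k ∣ p := Nat.dvd_of_mul_dvd_mul_left two_pos (hk ▸ hqdvd)
  have hcop : Nat.Coprime 2 k := (hpodd.of_dvd_nat hkp).coprime_two_left
  have hdvd : 2 * k ∣ orderOf (rho p q 1 * rho p q 2) :=
    hcop.mul_dvd_of_dvd_of_dvd (two_dvd_orderOf_rho_mul_right p q hqeven)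
      (dvd_orderOf_rho_mul_right hkp (hk ▸ dvd_mul_left k 2))
  rwa [← hk] at hdvd
end

section
/- Let G be a group and let a, b, c ∈ G satisfy a² = b² = c² = 1 and (abcbc)² = 1, and set ω = (bc)². Then each of a, b, c conjugates ω to ω⁻¹ (that is, aωa⁻¹ = bωb⁻¹ = cωc⁻¹ = ω⁻¹); consequently, if G is generated by a, b, c, then the cyclic subgroup generated by ω is a normal subgroup of G. -/
theorem conj_eq_inv_of_sq_eq_one {G : Type*} [Group G] {g w : G}
    (hg : g ^ 2 = 1) (hgw : (g * w) ^ 2 = 1) : g * w * g⁻¹ = w⁻¹ := by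
  rw [inv_eq_of_mul_eq_one_left (by rwa [pow_two] at hg : g * g = 1), eq_inv_iff_mul_eq_one,
    mul_assoc, ← pow_two, hgw]

theorem mem_normalizer_zpowers_of_conj_eq_inv {G : Type*} [Group G] {g w : G}
    (h : g * w * g⁻¹ = w⁻¹) : g ∈ Subgroup.normalizer (Subgroup.zpowers w : Set G) := by
  rw [Subgroup.mem_normalizer_iff_map_conj_eq, MonoidHom.map_zpowers]
  simp [h]


/-- Let `a, b, c` be elements of a group with `a² = b² = c² = 1` and `(abcbc)² = 1`, and set
`ω = (bc)²`. Then each of `a, b, c` conjugates `ω` to `ω⁻¹`; consequently, if the group is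
generated by `a, b, c`, then the cyclic subgroup generated by `ω` is normal. -/
theorem conj_inverts_omega {G : Type*} [Group G] (a b c : G)
    (ha : a ^ 2 = 1) (hb : b ^ 2 = 1) (hc : c ^ 2 = 1)
    (habcbc : (a * b * c * b * c) ^ 2 = 1) :
    a * (b * c) ^ 2 * a⁻¹ = ((b * c) ^ 2)⁻¹ ∧
    b * (b * c) ^ 2 * b⁻¹ = ((b * c) ^ 2)⁻¹ ∧
    c * (b * c) ^ 2 * c⁻¹ = ((b * c) ^ 2)⁻¹ ∧
    (Subgroup.closure ({a, b, c} : Set G) = ⊤ → (Subgroup.zpowers ((b * c) ^ 2)).Normal) := by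
  have hA : a * (b * c) ^ 2 * a⁻¹ = ((b * c) ^ 2)⁻¹ :=
    conj_eq_inv_of_sq_eq_one ha (by simpa only [pow_two, mul_assoc] using habcbc)
  have hbb : b * b = 1 := by rw [← pow_two, hb]
  have hcc : c * c = 1 := by rw [← pow_two, hc]
  have hbi : b⁻¹ = b := inv_eq_of_mul_eq_one_left hbb
  have hci : c⁻¹ = c := inv_eq_of_mul_eq_one_left hcc
  have hB : b * (b * c) ^ 2 * b⁻¹ = ((b * c) ^ 2)⁻¹ := by
    simp only [pow_two, mul_inv_rev, hbi, hci, ← mul_assoc, hbb, one_mul]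
  have hC : c * (b * c) ^ 2 * c⁻¹ = ((b * c) ^ 2)⁻¹ := by
    simp only [pow_two, mul_inv_rev, hbi, hci, mul_assoc, hcc, mul_one]
  refine ⟨hA, hB, hC, fun h => ?_⟩
  rw [← Subgroup.normalizer_eq_top_iff, eq_top_iff, ← h, Subgroup.closure_le]
  rintro x (rfl | rfl | rfl)
  exacts [mem_normalizer_zpowers_of_conj_eq_inv hA, mem_normalizer_zpowers_of_conj_eq_inv hB,
    mem_normalizer_zpowers_of_conj_eq_inv hC]
end

section
/- Let p be an odd positive integer, and let G be a group generated by two elements x and y such that x^p = 1 and (xy)² = 1, and such that the cyclic subgroup generated by y² is a normal subgroup of G. Then y² lies in the center of G, and y^{2p} = 1; in particular, the order of y divides 2p. -/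
/-- Let `p` be an odd positive integer and `G` a group generated by `x` and `y` with `x^p = 1`
and `(xy)² = 1`, such that the cyclic subgroup generated by `y²` is normal. Then `y²` is central,
`y^{2p} = 1`, and the order of `y` divides `2p`. -/
theorem central_sq_of_normal {G : Type*} [Group G] (p : ℕ) (hp0 : 0 < p) (hpodd : Odd p)
    (x y : G) (hgen : Subgroup.closure ({x, y} : Set G) = ⊤)
    (hx : x ^ p = 1) (hxy : (x * y) ^ 2 = 1)
    (hN : (Subgroup.zpowers (y ^ 2)).Normal) :
    y ^ 2 ∈ Subgroup.center G ∧ y ^ (2 * p) = 1 ∧ orderOf y ∣ 2 * p := by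
  have hconj : x * y ^ 2 * x⁻¹ ∈ Subgroup.zpowers (y ^ 2) :=
    hN.conj_mem _ (Subgroup.mem_zpowers _) x
  obtain ⟨k, hk⟩ := Subgroup.mem_zpowers_iff.mp hconj
  have hyconj : Commute y (x * y ^ 2 * x⁻¹) := by
    rw [← hk]
    exact ((Commute.refl y).pow_right 2).zpow_right k
  have hx2 : Commute (x ^ 2) (y ^ 2) := by
    have hcomm : Commute ((x * y) ^ 2) (y ^ 2) := hxy ▸ Commute.one_left _
    rw [commute_iff_eq, ← mul_inv_eq_iff_eq_mul] at hcomm ⊢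
    calc x ^ 2 * y ^ 2 * (x ^ 2)⁻¹
      _ = x * (x * y ^ 2 * x⁻¹) * x⁻¹ := by
        simp only [pow_two, mul_inv_rev, mul_assoc]
      _ = x * (y * (x * y ^ 2 * x⁻¹) * y⁻¹) * x⁻¹ := by
        rw [hyconj.eq, mul_inv_cancel_right]
      _ = (x * y) ^ 2 * y ^ 2 * ((x * y) ^ 2)⁻¹ := by
        simp only [pow_two, mul_inv_rev, mul_assoc, mul_inv_cancel_left]
      _ = y ^ 2 := hcomm
  have hxc : Commute x (y ^ 2) := by
    obtain ⟨m, hm⟩ := hpodd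
    have hxm : x = (x ^ 2) ^ (m + 1) := by
      rw [← pow_mul, show 2 * (m + 1) = p + 1 by omega, pow_succ, hx, one_mul]
    rw [hxm]
    exact hx2.pow_left _
  have hpow : y ^ (2 * p) = 1 := by
    have hinv : y * x * y⁻¹ = (x * y ^ 2)⁻¹ := by
      rw [eq_inv_iff_mul_eq_one, hxc.eq]
      have h : (y * x) * (y * x) = 1 := by
        have h' : x * (y * x * y) = 1 := by
          simpa [pow_two, mul_assoc] using hxy
        simpa [mul_assoc] using mul_eq_one_comm.mp h'
      simpa [pow_two, mul_assoc] using h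
    have h := congrArg (· ^ p) hinv
    simp only [conj_pow, inv_pow, hxc.mul_pow, hx, mul_one, mul_inv_cancel, one_mul] at h
    rw [pow_mul]
    exact inv_eq_one.mp h.symm
  refine ⟨?_, hpow, orderOf_dvd_of_pow_eq_one hpow⟩
  have hle : Subgroup.closure ({x, y} : Set G) ≤ Subgroup.centralizer {y ^ 2} := by
    rw [Subgroup.closure_le]
    rintro g (rfl | rfl)
    · exact Subgroup.mem_centralizer_singleton_iff.mpr hxc.eq
    · exact Subgroup.mem_centralizer_singleton_iff.mpr ((Commute.refl _).pow_right 2).eq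
  rw [Subgroup.mem_center_iff]
  intro g
  exact Subgroup.mem_centralizer_singleton_iff.mp (hle (hgen ▸ Subgroup.mem_top g))
end

section
/- Let p ≥ 3 be odd and let q ≥ 2 be an integer. Let G be a finite group generated by involutions ρ0, ρ1, ρ2 with (ρ0ρ2)² = 1, satisfying the intersection condition, such that ρ0ρ1 has order p, ρ1ρ2 has order q, |G| = 2pq, and the subgroup generated by ρ0ρ1 and ρ1ρ2 has index 2 in G. Then q is even, q divides 2p, and G is isomorphic to Γ(p,q) via an isomorphism matching the generators ρ0, ρ1, ρ2. -/
section

open scoped commutatorElement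

/-- If the orbit of `0` under `v ↦ γ v + x` is everything and `γ` is conjugate to its inverse by an
additive map sending `x` to `-γ⁻¹ x`, then `γ` fixes `x`. -/
theorem fixed_of_affine_orbit_surjective {V : Type*} [AddCommGroup V] (γ γ' T : V →+ V) (x : V)
    (s : ℕ → V) (hγ : ∀ v, γ (γ' v) = v) (hγ' : ∀ v, γ' (γ v) = v)
    (hTx : T x = -γ' x) (hT : ∀ v, T (γ v) = γ' (T v))
    (h0 : s 0 = 0) (hs : ∀ i, s (i + 1) = γ (s i) + x)
    (hsurj : ∀ v, ∃ i, s i = v) (h2 : ∀ v : V, v + v = 0 → v = 0) : γ x = x := by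
  have hs' : ∀ i, s (i + 1) = s i + γ^[i] x := by
    intro i
    induction i with
    | zero => simp [hs, h0]
    | succ i ih =>
      rw [hs (i + 1), ih, map_add, Function.iterate_succ_apply', ← ih, hs i]
      abel
  have hTi : ∀ i, T (γ^[i] x) = -γ'^[i + 1] x := by
    intro i
    induction i with
    | zero => simpa using hTx
    | succ i ih =>
      rw [Function.iterate_succ_apply', hT, ih, map_neg, ← Function.iterate_succ_apply' γ']
  have hcancel : ∀ i v, γ^[i] (γ'^[i] v) = v := fun i v =>
    (Function.RightInverse.iterate (f := γ) (g := γ') hγ i) v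
  obtain ⟨i, hi⟩ := hsurj (x + x)
  have e1 : γ^[i] x = γ x + γ x - x := by
    have h1 := hs' i
    rw [hs i, hi, map_add] at h1
    linear_combination (norm := module) (-1 : ℤ) • h1
  have e2 : γ'^[i] x = γ' x + γ' x - x := by
    have h1 := congrArg T e1
    rw [hTi, map_sub, map_add, hT, hTx, Function.iterate_succ_apply'] at h1
    have h3 := congrArg γ h1
    simp only [map_neg, map_sub, map_add, hγ] at h3
    linear_combination (norm := module) (-1 : ℤ) • h3
  have e3 : γ^[i] (γ' x) = x + x - γ' x := by
    have h1 : γ^[i] (γ' x) = γ' (γ^[i] x) := by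
      have := Function.iterate_succ_apply γ i (γ' x)
      rw [hγ, Function.iterate_succ_apply'] at this
      rw [← this, hγ']
    rw [h1, e1]; simp [hγ']
  have e4 : γ x + γ' x = x + x := by
    have h1 := congrArg (γ^[i]) e2
    rw [hcancel, iterate_map_sub, iterate_map_add, e3, e1] at h1
    rw [← sub_eq_zero]
    apply h2
    linear_combination (norm := module) (1 : ℤ) • h1
  have e5 : γ' x = x + x - γ x := by rw [← e4]; abel
  obtain ⟨y, hy⟩ : ∃ y, y = γ x - x := ⟨_, rfl⟩
  have hγx : γ x = x + y := by rw [hy]; abel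
  have hγy : γ y = y := by
    have h1 := congrArg γ e4
    rw [map_add, hγ, map_add, hγx, map_add, hγx] at h1
    linear_combination (norm := module) (1 : ℤ) • h1
  have hTy : T y = y := by
    have h1 : γ' (γ' x) = γ' x + γ' x - x := by
      conv_lhs => rw [e5]
      rw [map_sub, map_add, hγ']
    rw [hy, map_sub, hT, hTx, map_neg, h1, e5]; abel
  have hsum : ∀ i : ℕ, s i + s i = (2 * i : ℤ) • x + (i * (i - 1) : ℤ) • y := by
    intro i
    induction i with
    | zero => simp [h0]
    | succ i ih =>
      rw [hs, show γ (s i) + x + (γ (s i) + x) = γ (s i + s i) + x + x by rw [map_add]; abel, ih,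
        map_add, map_zsmul, map_zsmul, hγx, hγy]
      push_cast
      module
  obtain ⟨k, hk⟩ := hsurj y
  have f1 := hsum k
  rw [hk] at f1
  have f2 : (k : ℤ) • y = 0 := by
    apply h2
    have h1 := congrArg γ f1
    rw [map_add, map_add, map_zsmul, map_zsmul, hγx, hγy] at h1
    linear_combination (norm := module) (1 : ℤ) • f1 - (1 : ℤ) • h1
  have f3 : y = (k : ℤ) • x := by
    rw [← sub_eq_zero]
    apply h2
    linear_combination (norm := module) (1 : ℤ) • f1 + (k - 1 : ℤ) • f2
  have f4 : y = 0 := by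
    apply h2
    have h1 := congrArg T f3
    rw [hTy, map_zsmul, hTx, e5, hγx] at h1
    linear_combination (norm := module) (1 : ℤ) • h1 + (1 : ℤ) • f2 + (1 : ℤ) • f3
  rw [hγx, f4, add_zero]

theorem commutator_le_of_closure_eq_top {H : Type*} [Group H] {S : Set H}
    (hS : Subgroup.closure S = ⊤) (N : Subgroup H) [N.Normal]
    (hN : ∀ u ∈ S, ∀ v ∈ S, ⁅u, v⁆ ∈ N) : commutator H ≤ N := by
  have hc : ∀ u ∈ S, ∀ v ∈ S, Commute (u : H ⧸ N) (v : H ⧸ N) := by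
    intro u hu v hv
    rw [← commutatorElement_eq_one_iff_commute]
    exact (QuotientGroup.eq_one_iff _).2 (hN u hu v hv)
  have h1 : ∀ u ∈ S, ∀ h : H, Commute (u : H ⧸ N) (h : H ⧸ N) := by
    intro u hu h
    have hh : h ∈ Subgroup.closure S := hS ▸ Subgroup.mem_top h
    induction hh using Subgroup.closure_induction with
    | mem v hv => exact hc u hu v hv
    | one => exact Commute.one_right _
    | mul x y _ _ hx hy => exact hx.mul_right hy
    | inv x _ hx => exact hx.inv_right
  rw [commutator_def, Subgroup.commutator_le]
  rintro g - h -
  rw [← QuotientGroup.eq_one_iff]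
  have hg : g ∈ Subgroup.closure S := hS ▸ Subgroup.mem_top g
  have : Commute (g : H ⧸ N) (h : H ⧸ N) := by
    induction hg using Subgroup.closure_induction with
    | mem v hv => exact h1 v hv h
    | one => exact Commute.one_left _
    | mul x y _ _ hx hy => exact hx.mul_left hy
    | inv x _ hx => exact hx.inv_left
  exact commutatorElement_eq_one_iff_commute.2 this

/-- Itô's theorem: a product of two abelian subgroups is metabelian. -/
theorem commutator_commute_of_factorization {H : Type*} [Group H] {A B : Subgroup H}
    (hA : ∀ u ∈ A, ∀ v ∈ A, Commute u v) (hB : ∀ u ∈ B, ∀ v ∈ B, Commute u v)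
    (hAB : ∀ h : H, ∃ u ∈ A, ∃ v ∈ B, h = u * v) :
    ∀ u ∈ commutator H, ∀ v ∈ commutator H, Commute u v := by
  have hBA : ∀ h : H, ∃ v ∈ B, ∃ u ∈ A, h = v * u := by
    intro h
    obtain ⟨u, hu, v, hv, e⟩ := hAB h⁻¹
    exact ⟨v⁻¹, B.inv_mem hv, u⁻¹, A.inv_mem hu, by rw [← mul_inv_rev, ← e, inv_inv]⟩
  -- conjugation by either factor changes one entry of a commutator
  have conjA : ∀ u₁ ∈ A, ∀ v ∈ B, ∃ v₂ ∈ B, ∀ u ∈ A,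
      u₁ * ⁅u, v⁆ * u₁⁻¹ = ⁅u, v₂⁆ := by
    intro u₁ hu₁ v hv
    obtain ⟨v₂, hv₂, u₂, hu₂, e⟩ := hBA (u₁ * v * u₁⁻¹)
    refine ⟨v₂, hv₂, fun u hu => ?_⟩
    have h1 : u₁ * ⁅u, v⁆ * u₁⁻¹ = ⁅u₁ * u * u₁⁻¹, u₁ * v * u₁⁻¹⁆ := by
      simp only [commutatorElement_def]; group
    rw [h1, e, (hA u₁ hu₁ u hu).eq, mul_inv_cancel_right]
    have h2 := (hA u hu u₂ hu₂).inv_left.eq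
    simp only [commutatorElement_def, mul_inv_rev, mul_assoc]
    rw [← mul_assoc u₂ u⁻¹, ← h2]
    group
  have conjB : ∀ v₁ ∈ B, ∀ u ∈ A, ∃ u₂ ∈ A, ∀ v ∈ B, v₁ * ⁅u, v⁆ * v₁⁻¹ = ⁅u₂, v⁆ := by
    intro v₁ hv₁ u hu
    obtain ⟨u₂, hu₂, v₂, hv₂, e⟩ := hAB (v₁ * u * v₁⁻¹)
    refine ⟨u₂, hu₂, fun v hv => ?_⟩
    have h1 : v₁ * ⁅u, v⁆ * v₁⁻¹ = ⁅v₁ * u * v₁⁻¹, v₁ * v * v₁⁻¹⁆ := by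
      simp only [commutatorElement_def]; group
    rw [h1, e, (hB v₁ hv₁ v hv).eq, mul_inv_cancel_right]
    have h2 := (hB v₂ hv₂ v hv).eq
    simp only [commutatorElement_def, mul_inv_rev, mul_assoc]
    rw [← mul_assoc v₂ v, h2]
    group
  have hcomm : ∀ u ∈ A, ∀ v ∈ B, ∀ u₁ ∈ A, ∀ v₁ ∈ B, Commute ⁅u₁, v₁⁆ ⁅u, v⁆ := by
    intro u hu v hv u₁ hu₁ v₁ hv₁
    obtain ⟨v₂, hv₂, e2⟩ := conjA u₁⁻¹ (A.inv_mem hu₁) v hv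
    obtain ⟨u₂, hu₂, e3⟩ := conjB v₁⁻¹ (B.inv_mem hv₁) u hu
    have h1 : v₁⁻¹ * (u₁⁻¹ * ⁅u, v⁆ * u₁⁻¹⁻¹) * v₁⁻¹⁻¹ =
        u₁⁻¹ * (v₁⁻¹ * ⁅u, v⁆ * v₁⁻¹⁻¹) * u₁⁻¹⁻¹ := by
      rw [e2 u hu, e3 v₂ hv₂, e3 v hv, e2 u₂ hu₂]
    have h2 : ⁅u₁, v₁⁆ * ⁅u, v⁆ * ⁅u₁, v₁⁆⁻¹ =
        u₁ * v₁ * (u₁⁻¹ * (v₁⁻¹ * ⁅u, v⁆ * v₁⁻¹⁻¹) * u₁⁻¹⁻¹) * v₁⁻¹ * u₁⁻¹ := by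
      rw [commutatorElement_def u₁]; group
    rw [← h1] at h2
    have h3 : ⁅u₁, v₁⁆ * ⁅u, v⁆ * ⁅u₁, v₁⁆⁻¹ = ⁅u, v⁆ := by rw [h2]; group
    exact mul_inv_eq_iff_eq_mul.1 h3
  have hnorm : (⁅A, B⁆ : Subgroup H).Normal := by
    refine ⟨fun n hn g => ?_⟩
    obtain ⟨u₁, hu₁, v₁, hv₁, rfl⟩ := hAB g
    rw [Subgroup.commutator_def] at hn
    induction hn using Subgroup.closure_induction with
    | mem x hx =>
      obtain ⟨u, hu, v, hv, rfl⟩ := hx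
      obtain ⟨u₂, hu₂, e3⟩ := conjB v₁ hv₁ u hu
      obtain ⟨v₂, hv₂, e2⟩ := conjA u₁ hu₁ v hv
      have : u₁ * v₁ * ⁅u, v⁆ * (u₁ * v₁)⁻¹ = ⁅u₂, v₂⁆ := by
        rw [← e2 u₂ hu₂, ← e3 v hv]; group
      rw [this]
      exact Subgroup.commutator_mem_commutator hu₂ hv₂
    | one => simp
    | mul x y _ _ hx hy =>
      have := mul_mem hx hy
      rwa [show u₁ * v₁ * x * (u₁ * v₁)⁻¹ * (u₁ * v₁ * y * (u₁ * v₁)⁻¹) =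
        u₁ * v₁ * (x * y) * (u₁ * v₁)⁻¹ by group] at this
    | inv x _ hx =>
      have := inv_mem hx
      rwa [show (u₁ * v₁ * x * (u₁ * v₁)⁻¹)⁻¹ = u₁ * v₁ * x⁻¹ * (u₁ * v₁)⁻¹ by group] at this
  have hle : commutator H ≤ ⁅A, B⁆ := by
    refine commutator_le_of_closure_eq_top (S := A ∪ B) ?_ _ ?_
    · rw [eq_top_iff]
      intro h _
      obtain ⟨u, hu, v, hv, rfl⟩ := hAB h
      exact mul_mem (Subgroup.subset_closure (Or.inl hu)) (Subgroup.subset_closure (Or.inr hv))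
    · rintro u (hu | hu) v (hv | hv)
      · rw [commutatorElement_eq_one_iff_commute.2 (hA u hu v hv)]; exact one_mem _
      · exact Subgroup.commutator_mem_commutator hu hv
      · rw [← commutatorElement_inv]
        exact inv_mem (Subgroup.commutator_mem_commutator hv hu)
      · rw [commutatorElement_eq_one_iff_commute.2 (hB u hu v hv)]; exact one_mem _
  intro u hu v hv
  have hu' := hle hu
  have hv' := hle hv
  rw [Subgroup.commutator_def] at hu' hv'
  have h1 : ∀ u₁ ∈ A, ∀ v₁ ∈ B, Commute ⁅u₁, v₁⁆ v := by
    intro u₁ hu₁ v₁ hv₁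
    clear hv
    induction hv' using Subgroup.closure_induction with
    | mem x hx =>
      obtain ⟨u₂, hu₂, v₂, hv₂, rfl⟩ := hx
      exact hcomm u₂ hu₂ v₂ hv₂ u₁ hu₁ v₁ hv₁
    | one => exact Commute.one_right _
    | mul x y _ _ hx hy => exact hx.mul_right hy
    | inv x _ hx => exact hx.inv_right
  clear hu
  induction hu' using Subgroup.closure_induction with
  | mem x hx =>
    obtain ⟨u₂, hu₂, v₂, hv₂, rfl⟩ := hx
    exact h1 u₂ hu₂ v₂ hv₂
  | one => exact Commute.one_left _
  | mul x y _ _ hx hy => exact hx.mul_left hy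
  | inv x _ hx => exact hx.inv_left

/-- If `H = ⟨a⟩⟨b⟩` with trivial intersection, `a` of odd order, `(ab)² = 1` and some endomorphism
inverts both `a` and `b`, then `b²` is central. -/
theorem commute_sq_of_factorization {H : Type*} [Group H] [Finite H] {p : ℕ} (hp : Odd p)
    {a b : H} (ha : a ^ p = 1) (hcard : Nat.card H = p * orderOf b) (hab : (a * b) ^ 2 = 1)
    (hAB : ∀ h : H, ∃ i j : ℕ, h = a ^ i * b ^ j)
    (τ : H →* H) (hτa : τ a = a⁻¹) (hτb : τ b = b⁻¹) : Commute (b ^ 2) a := by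
  have hM : ∀ u ∈ commutator H, ∀ v ∈ commutator H, Commute u v := by
    refine commutator_commute_of_factorization (A := Subgroup.zpowers a)
      (B := Subgroup.zpowers b) ?_ ?_ ?_
    · rintro _ ⟨i, rfl⟩ _ ⟨j, rfl⟩
      exact Commute.zpow_zpow_self a i j
    · rintro _ ⟨i, rfl⟩ _ ⟨j, rfl⟩
      exact Commute.zpow_zpow_self b i j
    · intro h
      obtain ⟨i, j, rfl⟩ := hAB h
      exact ⟨a ^ i, Subgroup.npow_mem_zpowers a i, b ^ j, Subgroup.npow_mem_zpowers b j, rfl⟩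
  have hgen : Subgroup.closure {a, b} = ⊤ := by
    rw [eq_top_iff]
    intro h _
    obtain ⟨i, j, rfl⟩ := hAB h
    exact mul_mem (pow_mem (Subgroup.subset_closure (by simp)) i)
      (pow_mem (Subgroup.subset_closure (by simp)) j)
  obtain ⟨x, hx⟩ : ∃ x, x = a * b ^ (p + 1) := ⟨_, rfl⟩
  have hxM : x ∈ commutator H := by
    rw [← Abelianization.ker_of H, MonoidHom.mem_ker, hx, map_mul, map_pow]
    have h1 := congrArg (Abelianization.of (G := H)) hab
    have h2 := congrArg (Abelianization.of (G := H)) ha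
    rw [map_pow, map_mul, mul_pow, map_one] at h1
    rw [map_pow, map_one] at h2
    generalize Abelianization.of a = A at *
    generalize Abelianization.of b = B at *
    obtain ⟨k, rfl⟩ := hp
    have h3 : (A ^ 2 * B ^ 2) ^ (k + 1) = 1 := by rw [h1, one_pow]
    rw [mul_pow, ← pow_mul, ← pow_mul, show 2 * (k + 1) = (2 * k + 1) + 1 by ring, pow_succ A, h2,
      one_mul] at h3
    exact h3
  have ha' : a = x * (b ^ (p + 1))⁻¹ := by rw [hx, mul_inv_cancel_right]
  -- the map `m ↦ ⁅b, m⁆` is a bijection of the derived subgroup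
  have hδ : ∀ m ∈ commutator H, ∀ n ∈ commutator H, ⁅b, m * n⁆ = ⁅b, m⁆ * ⁅b, n⁆ := by
    intro m hm n hn
    have h1 : ⁅b, n⁆ ∈ commutator H :=
      Subgroup.commutator_mem_commutator (Subgroup.mem_top _) (Subgroup.mem_top _)
    have h2 := (hM m hm _ h1).eq
    have h3 : ⁅b, m * n⁆ = ⁅b, m⁆ * (m * ⁅b, n⁆) * m⁻¹ := by
      simp only [commutatorElement_def]; group
    rw [h3, h2]; group
  let δ : commutator H →* commutator H :=
    { toFun := fun m => ⟨⁅b, (m : H)⁆,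
        Subgroup.commutator_mem_commutator (Subgroup.mem_top _) (Subgroup.mem_top _)⟩
      map_one' := by ext; simp
      map_mul' := fun m n => Subtype.ext (hδ m m.2 n n.2) }
  have hδval : ∀ m, (δ m : H) = ⁅b, (m : H)⁆ := fun _ => rfl
  have hDn : (δ.range.map (commutator H).subtype).Normal := by
    refine ⟨?_⟩
    rintro _ ⟨_, ⟨m, rfl⟩, rfl⟩ h
    have hm' : h * m * h⁻¹ ∈ commutator H := Subgroup.Normal.conj_mem inferInstance _ m.2 h
    refine ⟨_, ⟨⟨h * m * h⁻¹, hm'⟩, rfl⟩, ?_⟩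
    have h1 : ⁅h, b⁆ ∈ commutator H :=
      Subgroup.commutator_mem_commutator (Subgroup.mem_top _) (Subgroup.mem_top _)
    have h2 : b * (h * m * h⁻¹) * b⁻¹ ∈ commutator H :=
      Subgroup.Normal.conj_mem inferInstance _ hm' b
    have h3 := (hM _ h1 _ h2).eq
    simp only [Subgroup.coe_subtype, hδval]
    have h4 : h * ⁅b, (m : H)⁆ * h⁻¹ =
        (⁅h, b⁆ * (b * (h * m * h⁻¹) * b⁻¹)) * ⁅h, b⁆⁻¹ * (h * m * h⁻¹)⁻¹ := by
      simp only [commutatorElement_def]; group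
    rw [h4, h3]
    simp only [commutatorElement_def]; group
  have hle : commutator H ≤ δ.range.map (commutator H).subtype := by
    have hba : ⁅b, a⁆ ∈ δ.range.map (commutator H).subtype := by
      refine ⟨_, ⟨⟨x, hxM⟩, rfl⟩, ?_⟩
      simp only [Subgroup.coe_subtype, hδval, hx, commutatorElement_def]
      group
    refine commutator_le_of_closure_eq_top hgen _ ?_
    rintro u (rfl | rfl) v (rfl | rfl)
    · simp
    · rw [← commutatorElement_inv]; exact inv_mem hba
    · exact hba
    · simp
  have hδsurj : Function.Surjective δ := by
    intro m
    obtain ⟨_, ⟨n, rfl⟩, e⟩ := hle m.2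
    exact ⟨n, Subtype.ext e⟩
  have hδinj : Function.Injective δ := Finite.injective_iff_surjective.2 hδsurj
  have hfix : ∀ m ∈ commutator H, Commute b m → m = 1 := by
    intro m hm hc
    have : δ ⟨m, hm⟩ = δ 1 := by
      rw [map_one]
      exact Subtype.ext (commutatorElement_eq_one_iff_commute.2 hc)
    exact congrArg Subtype.val (hδinj this)
  have hbM : ∀ i : ℤ, b ^ i ∈ commutator H → b ^ i = 1 := fun i hi =>
    hfix _ hi ((Commute.refl b).zpow_right i)
  -- the orbit of the affine map induced by `a`
  have hsM : ∀ i : ℕ, a ^ i * b ^ ((p + 1) * i) ∈ commutator H := by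
    intro i
    have h2 := hxM
    rw [← Abelianization.ker_of H, MonoidHom.mem_ker] at h2 ⊢
    rw [hx, map_mul, map_pow] at h2
    rw [map_mul, map_pow, map_pow, pow_mul, ← mul_pow, h2, one_pow]
  have hs : ∀ m ∈ commutator H, ∃ i : ℕ, m = a ^ i * b ^ ((p + 1) * i) := by
    intro m hm
    obtain ⟨i, j, e⟩ := hAB m
    refine ⟨i, ?_⟩
    have h1 := hsM i
    have h2 := mul_mem (inv_mem h1) hm
    have h3 : (a ^ i * b ^ ((p + 1) * i))⁻¹ * m = b ^ ((j : ℤ) - ((p + 1) * i : ℕ)) := by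
      rw [e, zpow_sub, zpow_natCast, zpow_natCast, (Commute.pow_pow_self b j _).inv_right.eq]
      group
    rw [h3] at h2
    rw [hbM _ h2] at h3
    exact (inv_mul_eq_one.1 h3).symm
  have hcardM : Nat.card (commutator H) = p := by
    have hc : Subgroup.IsComplement' (commutator H) (Subgroup.zpowers b) := by
      refine Subgroup.isComplement'_of_disjoint_and_mul_eq_univ ?_ ?_
      · rw [Subgroup.disjoint_def]
        rintro _ h1 ⟨i, rfl⟩
        exact hbM i h1
      · rw [Set.eq_univ_iff_forall]
        intro h
        obtain ⟨i, j, rfl⟩ := hAB h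
        have h1 := hsM i
        refine ⟨_, h1, (b ^ ((p + 1) * i))⁻¹ * b ^ j, ?_, ?_⟩
        · exact mul_mem (inv_mem (Subgroup.npow_mem_zpowers b _)) (Subgroup.npow_mem_zpowers b _)
        · group
    have h1 := hc.card_mul_card
    rw [hcard, Nat.card_zpowers] at h1
    exact Nat.eq_of_mul_eq_mul_right (orderOf_pos b) h1
  have hbp : (b ^ p)⁻¹ * x * b ^ p = x⁻¹ := by
    have h1 : x * ((b ^ p)⁻¹ * x * b ^ p) = b ^ (2 * p) := by
      have h2 : a * b = x * (b ^ p)⁻¹ := by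
        rw [ha', pow_succ]; group
      rw [h2, pow_two] at hab
      rw [two_mul, pow_add, ← mul_assoc, ← mul_assoc, ← mul_left_inj ((b ^ p)⁻¹)]
      rw [← mul_left_inj ((b ^ p)⁻¹)]
      group at hab ⊢
      exact hab
    have h2 : x * ((b ^ p)⁻¹ * x * b ^ p) ∈ commutator H := by
      refine mul_mem hxM ?_
      have := Subgroup.Normal.conj_mem (H := commutator H) inferInstance _ hxM (b ^ p)⁻¹
      rwa [inv_inv] at this
    have h3 := hfix _ h2 (h1 ▸ (Commute.refl b).pow_right _)
    exact eq_inv_of_mul_eq_one_right h3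
  have hγx : a * x * a⁻¹ = b⁻¹ * x⁻¹ * b := by
    have h1 : (b ^ (p + 1))⁻¹ * x * b ^ (p + 1) ∈ commutator H := by
      have := Subgroup.Normal.conj_mem (H := commutator H) inferInstance _ hxM (b ^ (p + 1))⁻¹
      rwa [inv_inv] at this
    have h2 : a * x * a⁻¹ = x * ((b ^ (p + 1))⁻¹ * x * b ^ (p + 1)) * x⁻¹ := by
      rw [ha']; group
    rw [h2, (hM _ hxM _ h1).eq, mul_inv_cancel_right, ← hbp, pow_succ]
    group
  have hτM : ∀ m ∈ commutator H, τ m ∈ commutator H := by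
    intro m hm
    have h1 : (commutator H).map τ ≤ commutator H := by
      rw [commutator_def, Subgroup.map_commutator]
      exact Subgroup.commutator_mono le_top le_top
    exact h1 ⟨m, hm, rfl⟩
  have hax : a * x * a⁻¹ = x := by
    let _ : CommGroup (commutator H) :=
      { (inferInstance : Group (commutator H)) with
        mul_comm := fun m n => Subtype.ext (hM m m.2 n n.2) }
    let T : commutator H →* commutator H :=
      (τ.comp (commutator H).subtype).codRestrict _ (fun m => hτM m m.2)
    refine congrArg (fun m => ((Additive.toMul m : commutator H) : H)) (fixed_of_affine_orbit_surjective (V := Additive (commutator H))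
      (MonoidHom.toAdditive (MulAut.conjNormal a).toMonoidHom)
      (MonoidHom.toAdditive (MulAut.conjNormal a⁻¹).toMonoidHom)
      (MonoidHom.toAdditive T) (Additive.ofMul ⟨x, hxM⟩)
      (fun i => Additive.ofMul ⟨a ^ i * b ^ ((p + 1) * i), hsM i⟩) ?_ ?_ ?_ ?_ ?_ ?_ ?_ ?_)
    · intro m
      refine Subtype.ext ?_
      change a * (a⁻¹ * (m.toMul : H) * a⁻¹⁻¹) * a⁻¹ = (m.toMul : H)
      group
    · intro m
      refine Subtype.ext ?_
      change a⁻¹ * (a * (m.toMul : H) * a⁻¹) * a⁻¹⁻¹ = (m.toMul : H)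
      group
    · refine Subtype.ext ?_
      change τ x = (a⁻¹ * x * a⁻¹⁻¹)⁻¹
      rw [hx, map_mul, map_pow, hτa, hτb]
      group
    · intro m
      refine Subtype.ext ?_
      change τ (a * (m.toMul : H) * a⁻¹) = a⁻¹ * τ (m.toMul : H) * a⁻¹⁻¹
      rw [map_mul, map_mul, map_inv, hτa]
    · refine Subtype.ext ?_
      change a ^ 0 * b ^ ((p + 1) * 0) = 1
      simp
    · intro i
      refine Subtype.ext ?_
      change a ^ (i + 1) * b ^ ((p + 1) * (i + 1)) =
        a * (a ^ i * b ^ ((p + 1) * i)) * a⁻¹ * x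
      rw [hx, pow_succ' a, Nat.mul_succ, pow_add]
      group
    · intro m
      obtain ⟨i, hi⟩ := hs m.toMul m.toMul.2
      exact ⟨i, Subtype.ext hi.symm⟩
    · intro m hm
      have h1 : m.toMul ^ 2 = 1 := by rw [pow_two]; exact hm
      have h2 : m.toMul ^ p = 1 := by rw [← hcardM]; exact pow_card_eq_one'
      have h3 : m.toMul ^ Nat.gcd 2 p = 1 := pow_gcd_eq_one.2 ⟨h1, h2⟩
      rw [(Nat.coprime_two_left.2 hp : Nat.gcd 2 p = 1), pow_one] at h3
      exact h3
  have hc : Commute (b ^ (p + 1)) x := by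
    have h1 : b ^ (p + 1) = a⁻¹ * x := by rw [hx]; group
    rw [h1]
    have h2 : Commute a x := mul_inv_eq_iff_eq_mul.1 hax
    exact h2.inv_left.mul_left (Commute.refl x)
  have hbx : b * x * b⁻¹ = x⁻¹ := by
    rw [← hbp]
    have h1 : (b ^ (p + 1))⁻¹ * x * b ^ (p + 1) = x := by
      rw [mul_assoc, ← hc.eq]; group
    nth_rw 1 [← h1]
    rw [pow_succ]
    group
  have hb2x : Commute (b ^ 2) x := by
    have h1 : b ^ 2 * x * (b ^ 2)⁻¹ = b * (b * x * b⁻¹) * b⁻¹ := by rw [pow_two]; group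
    rw [hbx, ← conj_inv, hbx, inv_inv] at h1
    exact mul_inv_eq_iff_eq_mul.1 h1
  rw [ha']
  exact hb2x.mul_right (Commute.pow_pow_self b 2 _).inv_right

end

theorem mul_zpow_of_commute_sq {H : Type*} [Group H] {a b : H} (hab : (a * b) ^ 2 = 1)
    (hc : Commute (b ^ 2) a) (i : ℤ) : b * a ^ i = a ^ (-i) * b ^ (-2 * i) * b := by
  have h1 : b * a * b⁻¹ = a⁻¹ * (b ^ 2)⁻¹ := by
    have h2 : b * a * b = a⁻¹ := by
      rw [pow_two] at hab
      rw [← mul_right_inj a, mul_inv_cancel, ← hab]; group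
    rw [← h2, pow_two]; group
  have h3 := congrArg (fun g => g ^ i) h1
  simp only [conj_zpow] at h3
  rw [mul_inv_eq_iff_eq_mul, hc.inv_inv.symm.mul_zpow] at h3
  rw [h3, zpow_mul, zpow_neg, inv_zpow, zpow_neg, zpow_ofNat, inv_zpow]

theorem finite_and_card_le_of_gamma2Rels {G : Type*} [Group G] {p q : ℕ} (hp : 0 < p) (hq : 0 < q)
    {r₀ r₁ r₂ : G} (hgen : Subgroup.closure {r₀, r₁, r₂} = ⊤)
    (h0 : r₀ ^ 2 = 1) (h1 : r₁ ^ 2 = 1) (h2 : r₂ ^ 2 = 1) (h01 : (r₀ * r₁) ^ p = 1)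
    (h12 : (r₁ * r₂) ^ q = 1) (h02 : (r₀ * r₂) ^ 2 = 1)
    (hrel : (r₀ * r₁ * r₂ * r₁ * r₂) ^ 2 = 1) : Finite G ∧ Nat.card G ≤ 2 * p * q := by
  have i0 : r₀⁻¹ = r₀ := inv_eq_of_mul_eq_one_right (by rw [← pow_two, h0])
  have i1 : r₁⁻¹ = r₁ := inv_eq_of_mul_eq_one_right (by rw [← pow_two, h1])
  have i2 : r₂⁻¹ = r₂ := inv_eq_of_mul_eq_one_right (by rw [← pow_two, h2])
  obtain ⟨a, ha⟩ : ∃ a, a = r₀ * r₁ := ⟨_, rfl⟩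
  obtain ⟨b, hb⟩ : ∃ b, b = r₁ * r₂ := ⟨_, rfl⟩
  have ca : r₁ * a * r₁⁻¹ = a⁻¹ := by
    rw [ha, mul_inv_rev, i0, ← mul_assoc, mul_inv_cancel_right, i1]
  have cb : r₁ * b * r₁⁻¹ = b⁻¹ := by
    rw [hb, mul_inv_rev, i2, ← mul_assoc, ← pow_two, h1, one_mul]
  have e0 : r₀ = a * r₁ := by rw [ha, mul_assoc, ← pow_two, h1, mul_one]
  have e2 : r₂ = r₁ * b := by rw [hb, ← mul_assoc, ← pow_two, h1, one_mul]
  have hab : (a * b) ^ 2 = 1 := by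
    rw [← h02, e2, e0]; simp only [mul_assoc]
    rw [← mul_assoc r₁ r₁, ← pow_two r₁, h1, one_mul]
  have hcomm : Commute (b ^ 2) a := by
    have k1 : r₀ * b ^ 2 * r₀⁻¹ = (b ^ 2)⁻¹ := by
      have : r₀ * r₁ * r₂ * r₁ * r₂ = r₀ * b ^ 2 := by rw [hb, pow_two]; group
      rw [this, pow_two] at hrel
      rw [i0]
      exact eq_inv_of_mul_eq_one_left (by rw [← hrel]; group)
    have k2 : r₁ * b ^ 2 * r₁⁻¹ = (b ^ 2)⁻¹ := by rw [← conj_pow, cb, inv_pow]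
    have k3 : a * b ^ 2 * a⁻¹ = b ^ 2 := by
      rw [ha]
      calc r₀ * r₁ * b ^ 2 * (r₀ * r₁)⁻¹ = r₀ * (r₁ * b ^ 2 * r₁⁻¹) * r₀⁻¹ := by group
        _ = b ^ 2 := by rw [k2, ← conj_inv, k1, inv_inv]
    exact (mul_inv_eq_iff_eq_mul.1 k3).symm
  let P : G → Prop := fun g => ∃ i j k : ℤ, g = a ^ i * b ^ j * r₁ ^ k
  have Pa : ∀ g, P g → P (a * g) := by
    rintro _ ⟨i, j, k, rfl⟩
    exact ⟨1 + i, j, k, by rw [zpow_add]; group⟩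
  have Pb : ∀ g, P g → P (b * g) := by
    rintro _ ⟨i, j, k, rfl⟩
    refine ⟨-i, -2 * i + 1 + j, k, ?_⟩
    rw [← mul_assoc, ← mul_assoc, mul_zpow_of_commute_sq hab hcomm, zpow_add, zpow_add]
    group
  have P1 : ∀ g, P g → P (r₁ * g) := by
    rintro _ ⟨i, j, k, rfl⟩
    refine ⟨-i, -j, 1 + k, ?_⟩
    have ca' := congrArg (· ^ i) ca
    have cb' := congrArg (· ^ j) cb
    simp only [conj_zpow, inv_zpow'] at ca' cb'
    rw [← ca', ← cb', zpow_add]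
    group
  have hP : ∀ g, P g := by
    intro g
    have hg : g ∈ Subgroup.closure {r₀, r₁, r₂} := hgen ▸ Subgroup.mem_top g
    have hmul : ∀ x ∈ ({r₀, r₁, r₂} : Set G), ∀ y, P y → P (x * y) := by
      rintro x (rfl | rfl | rfl) y hy
      · rw [e0, mul_assoc]; exact Pa _ (P1 _ hy)
      · exact P1 _ hy
      · rw [e2, mul_assoc]; exact P1 _ (Pb _ hy)
    induction hg using Subgroup.closure_induction_left with
    | one => exact ⟨0, 0, 0, by simp⟩
    | mul_left x hx y _ hy => exact hmul x hx y hy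
    | inv_mul_cancel x hx y _ hy =>
      have hx' : x⁻¹ = x := by
        obtain rfl | rfl | rfl := hx
        exacts [i0, i1, i2]
      rw [hx']; exact hmul x hx y hy
  have hsurj : Function.Surjective (fun t : Subgroup.zpowers a × Subgroup.zpowers b ×
      Subgroup.zpowers r₁ => (t.1 * t.2.1 * t.2.2 : G)) := by
    intro g
    obtain ⟨i, j, k, rfl⟩ := hP g
    exact ⟨⟨⟨_, i, rfl⟩, ⟨_, j, rfl⟩, ⟨_, k, rfl⟩⟩, rfl⟩
  rw [← ha] at h01
  rw [← hb] at h12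
  have fa : Finite (Subgroup.zpowers a) :=
    finite_zpowers.2 (isOfFinOrder_iff_pow_eq_one.2 ⟨p, hp, h01⟩)
  have fb : Finite (Subgroup.zpowers b) :=
    finite_zpowers.2 (isOfFinOrder_iff_pow_eq_one.2 ⟨q, hq, h12⟩)
  have f1 : Finite (Subgroup.zpowers r₁) :=
    finite_zpowers.2 (isOfFinOrder_iff_pow_eq_one.2 ⟨2, two_pos, h1⟩)
  refine ⟨Finite.of_surjective _ hsurj, (Nat.card_le_card_of_surjective _ hsurj).trans ?_⟩
  rw [Nat.card_prod, Nat.card_prod, Nat.card_zpowers, Nat.card_zpowers, Nat.card_zpowers]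
  calc orderOf a * (orderOf b * orderOf r₁) ≤ p * (q * 2) :=
        Nat.mul_le_mul (orderOf_le_of_pow_eq_one hp h01)
          (Nat.mul_le_mul (orderOf_le_of_pow_eq_one hq h12) (orderOf_le_of_pow_eq_one two_pos h1))
    _ = 2 * p * q := by ring

/-- Let `p ≥ 3` be odd and `q ≥ 2`. If `G` is a finite group generated by involutions
`ρ0, ρ1, ρ2` with `(ρ0ρ2)² = 1`, satisfying the intersection condition, with `ρ0ρ1` of order
`p`, `ρ1ρ2` of order `q`, `|G| = 2pq`, and `⟨ρ0ρ1, ρ1ρ2⟩` of index 2 (i.e. `G` is the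
automorphism group of a tight orientably-regular polyhedron of type `{p,q}`), then `q` is even,
`q` divides `2p`, and `G ≅ Γ(p,q)` matching the generators. -/
theorem tight_orientably_regular_polyhedron_classification
    (p q : ℕ) (hp3 : 3 ≤ p) (hpodd : Odd p) (hq2 : 2 ≤ q)
    (G : Type*) [Group G] [Finite G] (ρ : Fin 3 → G)
    (hinv : ∀ i, orderOf (ρ i) = 2)
    (hgen : Subgroup.closure (Set.range ρ) = ⊤)
    (hcomm : (ρ 0 * ρ 2) ^ 2 = 1)
    (hic : interCond ρ)
    (h01 : orderOf (ρ 0 * ρ 1) = p)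
    (h12 : orderOf (ρ 1 * ρ 2) = q)
    (hcard : Nat.card G = 2 * p * q)
    (hidx : (Subgroup.closure ({ρ 0 * ρ 1, ρ 1 * ρ 2} : Set G)).index = 2) :
    Even q ∧ q ∣ 2 * p ∧ ∃ φ : Gamma2 p q ≃* G, ∀ i : Fin 3, φ (rho p q i) = ρ i := by
  have hρ : ∀ i, ρ i ^ 2 = 1 := fun i => by rw [← hinv i, pow_orderOf_eq_one]
  have hρ' : ∀ i, (ρ i)⁻¹ = ρ i := fun i =>
    inv_eq_of_mul_eq_one_right (by rw [← pow_two, hρ])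
  have hρne : ∀ i, ρ i ≠ 1 := fun i h => by
    have := hinv i
    rw [h, orderOf_one] at this
    omega
  let H : Subgroup G := Subgroup.closure {ρ 0 * ρ 1, ρ 1 * ρ 2}
  have hHn : H.Normal := Subgroup.normal_of_index_eq_two hidx
  let a : H := ⟨ρ 0 * ρ 1, Subgroup.subset_closure (by simp)⟩
  let b : H := ⟨ρ 1 * ρ 2, Subgroup.subset_closure (by simp)⟩
  have oa : orderOf a = p := by rw [← h01]; exact (Subgroup.orderOf_coe a).symm
  have ob : orderOf b = q := by rw [← h12]; exact (Subgroup.orderOf_coe b).symm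
  have hcardH : Nat.card H = p * q := by
    have h1 : Nat.card H * 2 = 2 * p * q := by
      rw [← hcard, ← Subgroup.card_mul_index H]
      exact congrArg _ hidx.symm
    linarith
  have hval : ((a * b : H) : G) = ρ 0 * ρ 2 := by
    change ρ 0 * ρ 1 * (ρ 1 * ρ 2) = _
    rw [mul_assoc, ← mul_assoc (ρ 1), ← pow_two, hρ, one_mul]
  have hab : (a * b) ^ 2 = 1 := by
    refine Subtype.ext ?_
    rw [Subgroup.coe_pow, hval, hcomm]
    rfl
  have h1H : ρ 1 ∉ H := by
    intro h1
    have h0 : ρ 0 ∈ H := by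
      have := mul_mem a.2 (inv_mem h1)
      rwa [show ((a : H) : G) * (ρ 1)⁻¹ = ρ 0 from mul_inv_cancel_right _ _] at this
    have h2 : ρ 2 ∈ H := by
      have := mul_mem (inv_mem h1) b.2
      rwa [show (ρ 1)⁻¹ * ((b : H) : G) = ρ 2 from inv_mul_cancel_left _ _] at this
    have htop : H = ⊤ := by
      rw [eq_top_iff, ← hgen, Subgroup.closure_le]
      rintro _ ⟨i, rfl⟩
      fin_cases i
      exacts [h0, h1, h2]
    have h3 : H.index = 2 := hidx
    rw [htop, Subgroup.index_top] at h3
    omega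
  have hdisj : Disjoint (Subgroup.zpowers a) (Subgroup.zpowers b) := by
    rw [Subgroup.disjoint_def]
    rintro x ⟨i, hi⟩ ⟨j, hj⟩
    have hx : (x : G) ∈ Subgroup.closure (ρ '' {0, 1}) ⊓ Subgroup.closure (ρ '' {1, 2}) := by
      refine ⟨?_, ?_⟩
      · rw [← hi]
        exact zpow_mem (mul_mem (Subgroup.subset_closure (Set.mem_image_of_mem ρ (by simp)))
          (Subgroup.subset_closure (Set.mem_image_of_mem ρ (by simp)))) i
      · rw [← hj]
        exact zpow_mem (mul_mem (Subgroup.subset_closure (Set.mem_image_of_mem ρ (by simp)))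
          (Subgroup.subset_closure (Set.mem_image_of_mem ρ (by simp)))) j
    rw [hic, show ({0, 1} ∩ {1, 2} : Set (Fin 3)) = {1} by ext k; fin_cases k <;> simp,
      Set.image_singleton, Subgroup.mem_closure_singleton] at hx
    obtain ⟨n, hn⟩ := hx
    refine Subtype.ext ?_
    obtain ⟨m, rfl | rfl⟩ := n.even_or_odd'
    · rw [← hn, zpow_mul, zpow_ofNat, hρ, one_zpow]; rfl
    · rw [zpow_add_one, zpow_mul, zpow_ofNat, hρ, one_zpow, one_mul] at hn
      exact absurd (hn ▸ x.2) h1H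
  have hAB : ∀ h : H, ∃ i j : ℕ, h = a ^ i * b ^ j := by
    intro h
    have hc : Subgroup.IsComplement' (Subgroup.zpowers a) (Subgroup.zpowers b) :=
      Subgroup.isComplement'_of_card_mul_and_disjoint
        (by rw [Nat.card_zpowers, Nat.card_zpowers, oa, ob, hcardH]) hdisj
    obtain ⟨⟨⟨x, hx⟩, ⟨y, hy⟩⟩, e⟩ := hc.2 h
    obtain ⟨i, rfl⟩ := mem_powers_iff_mem_zpowers.2 hx
    obtain ⟨j, rfl⟩ := mem_powers_iff_mem_zpowers.2 hy
    exact ⟨i, j, e.symm⟩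
  have hc : Commute (b ^ 2) a := by
    refine commute_sq_of_factorization hpodd (oa ▸ pow_orderOf_eq_one a) (by rw [hcardH, ob]) hab
      hAB (MulAut.conjNormal (ρ 1)).toMonoidHom ?_ ?_
    · refine Subtype.ext ?_
      change ρ 1 * (ρ 0 * ρ 1) * (ρ 1)⁻¹ = (ρ 0 * ρ 1)⁻¹
      rw [mul_inv_rev, hρ' 0, ← mul_assoc, mul_inv_cancel_right, hρ']
    · refine Subtype.ext ?_
      change ρ 1 * (ρ 1 * ρ 2) * (ρ 1)⁻¹ = (ρ 1 * ρ 2)⁻¹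
      rw [mul_inv_rev, hρ' 2, ← mul_assoc (ρ 1), ← pow_two, hρ, one_mul]
  have hap : a ^ p = 1 := oa ▸ pow_orderOf_eq_one a
  have hqeven : Even q := by
    have h1 : orderOf (a * b) = 2 := by
      refine orderOf_eq_prime hab fun h => ?_
      have h02 : ρ 0 = ρ 2 := by
        rw [← hρ' 2]
        refine eq_inv_of_mul_eq_one_left ?_
        rw [← hval, h]; rfl
      have h3 : ρ 0 ∈ Subgroup.closure (ρ '' {0}) ⊓ Subgroup.closure (ρ '' {2}) :=
        ⟨Subgroup.subset_closure ⟨0, by simp⟩, Subgroup.subset_closure ⟨2, by simp [h02]⟩⟩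
      rw [hic, show ({0} ∩ {2} : Set (Fin 3)) = ∅ by ext k; fin_cases k <;> simp,
        Set.image_empty, Subgroup.closure_empty, Subgroup.mem_bot] at h3
      exact hρne 0 h3
    have h2 := orderOf_dvd_natCard (a * b)
    rw [h1, hcardH] at h2
    exact even_iff_two_dvd.2 ((Nat.coprime_two_left.2 hpodd).dvd_of_dvd_mul_left h2)
  have hqdvd : q ∣ 2 * p := by
    have h1 := mul_zpow_of_commute_sq hab hc p
    rw [zpow_natCast, hap, mul_one, zpow_neg, zpow_natCast, hap, inv_one, one_mul, neg_mul, zpow_neg,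
      right_eq_mul] at h1
    rw [← ob]
    exact orderOf_dvd_of_pow_eq_one (by exact_mod_cast inv_eq_one.1 h1)
  refine ⟨hqeven, hqdvd, ?_⟩
  have hrel : (ρ 0 * ρ 1 * ρ 2 * ρ 1 * ρ 2) ^ 2 = 1 := by
    have h1 : ρ 0 * ρ 1 * (ρ 1 * ρ 2) ^ 2 * (ρ 0 * ρ 1)⁻¹ = (ρ 1 * ρ 2) ^ 2 :=
      mul_inv_eq_iff_eq_mul.2 (congrArg Subtype.val hc.eq.symm)
    have h2 : ρ 1 * (ρ 1 * ρ 2) ^ 2 * (ρ 1)⁻¹ = ((ρ 1 * ρ 2) ^ 2)⁻¹ := by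
      rw [← conj_pow, ← mul_assoc, ← pow_two, hρ, one_mul, ← inv_pow, mul_inv_rev, hρ' 2]
    have h3 : ρ 0 * (ρ 1 * ρ 2) ^ 2 * ρ 0 = ((ρ 1 * ρ 2) ^ 2)⁻¹ := by
      have h4 : ρ 0 * ρ 1 * (ρ 1 * ρ 2) ^ 2 * (ρ 0 * ρ 1)⁻¹ =
          ρ 0 * (ρ 1 * (ρ 1 * ρ 2) ^ 2 * (ρ 1)⁻¹) * (ρ 0)⁻¹ := by group
      rw [h1, h2, ← conj_inv, hρ' 0] at h4
      exact inv_eq_iff_eq_inv.1 h4.symm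
    rw [show ρ 0 * ρ 1 * ρ 2 * ρ 1 * ρ 2 = ρ 0 * (ρ 1 * ρ 2) ^ 2 by rw [pow_two]; group, pow_two,
      ← mul_assoc, h3, inv_mul_cancel]
  have hlift : ∀ r ∈ gamma2Rels p q, FreeGroup.lift ρ r = 1 := by
    rintro r (rfl | rfl | rfl | rfl | rfl | rfl | rfl) <;>
      simp only [map_pow, map_mul, FreeGroup.lift_apply_of, hρ, hcomm, hrel]
    · rw [← h01, pow_orderOf_eq_one]
    · rw [← h12, pow_orderOf_eq_one]
  let φ : Gamma2 p q →* G := PresentedGroup.toGroup hlift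
  have hφ : ∀ i, φ (rho p q i) = ρ i := fun i => PresentedGroup.toGroup.of hlift
  have hφs : Function.Surjective φ := by
    rw [← MonoidHom.range_eq_top, eq_top_iff, ← hgen, Subgroup.closure_le]
    rintro _ ⟨i, rfl⟩
    exact ⟨_, hφ i⟩
  have hone : ∀ r ∈ gamma2Rels p q, PresentedGroup.mk (gamma2Rels p q) r = 1 := fun r hr =>
    PresentedGroup.one_of_mem hr
  obtain ⟨hfin, hle⟩ := finite_and_card_le_of_gamma2Rels (G := Gamma2 p q) (p := p) (q := q)
    (r₀ := rho p q 0) (r₁ := rho p q 1) (r₂ := rho p q 2) (by omega) (by omega)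
    (by
      rw [← PresentedGroup.closure_range_of]
      congr 1
      ext g
      simp [Fin.exists_fin_succ, rho, eq_comm])
    (hone (.of 0 ^ 2) (by simp [gamma2Rels])) (hone (.of 1 ^ 2) (by simp [gamma2Rels]))
    (hone (.of 2 ^ 2) (by simp [gamma2Rels])) (hone ((.of 0 * .of 1) ^ p) (by simp [gamma2Rels]))
    (hone ((.of 1 * .of 2) ^ q) (by simp [gamma2Rels]))
    (hone ((.of 0 * .of 2) ^ 2) (by simp [gamma2Rels]))
    (hone ((.of 0 * .of 1 * .of 2 * .of 1 * .of 2) ^ 2) (by simp [gamma2Rels]))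
  exact ⟨MulEquiv.ofBijective φ (hφs.bijective_of_nat_card_le (hcard ▸ hle)), hφ⟩
end
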